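/- arXiv:0710.0267 — 2 statements merged into one kernel-verified Lean document; each statement's English description precedes it below -/
import Mathlib

section
/- Let A be a real von Neumann regular poring such that the set X = {p ∈ Spec A : exactly one prime cone α ∈ Sper A satisfies supp(α) = p} is dense in Spec A (with the Zariski topology). Then A has a unique real closure *. -/
universe u

/-- A partial ordering (positive cone) of a commutative ring: closed under addition and
multiplication, contains all squares, and intersects its negative only in `0`. -/
def IsPartialOrdering {A : Type*} [CommRing A] (P : Set A) : Prop :=
  (∀ a ∈ P, ∀ b ∈ P, a + b ∈ P) ∧ (∀ a ∈ P, ∀ b ∈ P, a * b ∈ P) ∧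
  (∀ a : A, a ^ 2 ∈ P) ∧ (∀ a ∈ P, -a ∈ P → a = 0)

/-- A (formally) real ring: a sum of squares vanishes only if each term vanishes. -/
def IsRealRing (A : Type*) [CommRing A] : Prop :=
  ∀ (n : ℕ) (f : Fin n → A), (∑ i, f i ^ 2) = 0 → ∀ i, f i = 0

/-- A von Neumann regular commutative ring. -/
def IsVonNeumannRegular (A : Type*) [CommRing A] : Prop :=
  ∀ a : A, ∃ b : A, a = a ^ 2 * b

/-- A Baer ring: the annihilator of every subset is generated by an idempotent. -/
def IsBaerRing (A : Type*) [CommRing A] : Prop :=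
  ∀ S : Set A, ∃ e : A, e * e = e ∧ ∀ x : A, (∀ s ∈ S, x * s = 0) ↔ ∃ y : A, x = e * y

/-- An essential (ring) extension: an injective ring homomorphism such that every nonzero
ideal of the codomain meets the image of the domain nontrivially. -/
def IsEssentialExtension {A B : Type*} [CommRing A] [CommRing B] (f : A →+* B) : Prop :=
  Function.Injective f ∧ ∀ J : Ideal B, J ≠ ⊥ → ∃ a : A, f a ∈ J ∧ f a ≠ 0

/-- A real ring is real closed * if it admits no proper essential integral extension
which is again a real ring. -/
def IsRealClosedStar (B : Type u) [CommRing B] : Prop :=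
  IsRealRing B ∧ ∀ (C : Type u) [CommRing C] (f : B →+* C),
    IsRealRing C → IsEssentialExtension f → f.IsIntegral → Function.Surjective f

/-- `(B, Q)` together with the embedding `f` is a real closure * of the poring `(A, P)`:
`B` is a real closed * ring, an essential and integral extension of `A`, whose partial
ordering `Q` extends `P`. -/
structure IsRealClosureStarOf (A : Type u) [CommRing A] (P : Set A)
    (B : Type u) [CommRing B] (Q : Set B) (f : A →+* B) : Prop where
  pos_partial : IsPartialOrdering Q
  rcs : IsRealClosedStar B
  essential : IsEssentialExtension f
  integral : f.IsIntegral
  mono : ∀ a ∈ P, f a ∈ Q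

/-- Bundled real closure * of a poring `(A, P)`. -/
structure RealClosureStar (A : Type u) [CommRing A] (P : Set A) : Type (u + 1) where
  carrier : Type u
  [ring : CommRing carrier]
  pos : Set carrier
  emb : A →+* carrier
  is : IsRealClosureStarOf A P carrier pos emb

attribute [instance] RealClosureStar.ring

/-- Two real closures * of `(A, P)` are `A`-isomorphic: there is a ring isomorphism over
`A` preserving the partial orderings in both directions. -/
def RealClosureStar.AIso {A : Type u} [CommRing A] {P : Set A}
    (B C : RealClosureStar A P) : Prop :=
  ∃ e : B.carrier ≃+* C.carrier, (∀ a : A, e (B.emb a) = C.emb a) ∧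
    ∀ b : B.carrier, b ∈ B.pos ↔ e b ∈ C.pos

/-- A poring `(A, P)` has a unique real closure *: one exists, and any two are
`A`-isomorphic as porings. -/
def HasUniqueRealClosureStar (A : Type u) [CommRing A] (P : Set A) : Prop :=
  Nonempty (RealClosureStar A P) ∧ ∀ B C : RealClosureStar A P, B.AIso C

/-- A prime cone of a commutative ring. -/
structure PrimeCone (A : Type u) [CommRing A] : Type u where
  carrier : Set A
  add_mem : ∀ a ∈ carrier, ∀ b ∈ carrier, a + b ∈ carrier
  mul_mem : ∀ a ∈ carrier, ∀ b ∈ carrier, a * b ∈ carrier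
  sq_mem : ∀ a : A, a ^ 2 ∈ carrier
  mem_or_neg_mem : ∀ a : A, a ∈ carrier ∨ -a ∈ carrier
  support : Ideal A
  mem_support : ∀ a : A, a ∈ support ↔ a ∈ carrier ∧ -a ∈ carrier
  support_isPrime : support.IsPrime

/-- The real spectrum of a poring `(A, P)`: the prime cones containing `P`. -/
def RealSpectrum (A : Type u) [CommRing A] (P : Set A) : Type u :=
  {α : PrimeCone A // P ⊆ α.carrier}

/-- A real closed field: formally real, every element or its negative is a square, and
every polynomial of odd degree has a root. -/
def IsRealClosedField (F : Type u) [Field F] : Prop :=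
  IsRealRing F ∧ (∀ x : F, (∃ y : F, y ^ 2 = x) ∨ ∃ y : F, y ^ 2 = -x) ∧
    ∀ p : Polynomial F, Odd p.natDegree → ∃ x : F, Polynomial.eval x p = 0

/-- A total ordering (positive cone) of a ring. -/
def IsTotalOrderingCone {K : Type*} [CommRing K] (T : Set K) : Prop :=
  (∀ a ∈ T, ∀ b ∈ T, a + b ∈ T) ∧ (∀ a ∈ T, ∀ b ∈ T, a * b ∈ T) ∧
  (∀ x : K, x ∈ T ∨ -x ∈ T) ∧ ∀ x ∈ T, -x ∈ T → x = 0

open Polynomial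

/-- In a partially ordered ring without nilpotents, vanishing sums of squares are trivial. -/
theorem IsPartialOrdering.isRealRing {A : Type*} [CommRing A] [IsReduced A] {P : Set A}
    (hP : IsPartialOrdering P) : IsRealRing A := by
  obtain ⟨hadd, -, hsq, hneg⟩ := hP
  have h0 : (0 : A) ∈ P := by simpa using hsq 0
  intro n f hf i
  have hsum : ∀ s : Finset (Fin n), ∑ j ∈ s, f j ^ 2 ∈ P := by
    intro s
    induction s using Finset.induction_on with
    | empty => simpa using h0
    | insert a s ha ih => rw [Finset.sum_insert ha]; exact hadd _ (hsq _) _ ih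
  have h1 : -(f i ^ 2) ∈ P := by
    have h2 : -(f i ^ 2) = ∑ j ∈ Finset.univ.erase i, f j ^ 2 := by
      rw [← Finset.add_sum_erase _ _ (Finset.mem_univ i)] at hf
      linear_combination -hf
    rw [h2]
    exact hsum _
  exact pow_eq_zero_iff two_ne_zero |>.mp (hneg _ (hsq _) h1)

theorem IsRealRing.sq_add_sq {A : Type*} [CommRing A] (h : IsRealRing A) {a b : A}
    (hab : a ^ 2 + b ^ 2 = 0) : a = 0 ∧ b = 0 := by
  have := h 2 ![a, b] (by simpa [Fin.sum_univ_two] using hab)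
  exact ⟨this 0, this 1⟩

theorem IsRealRing.eq_zero_of_sq {A : Type*} [CommRing A] (h : IsRealRing A) {a : A}
    (ha : a ^ 2 = 0) : a = 0 :=
  h 1 (fun _ => a) (by simpa using ha) 0

theorem IsRealRing.isReduced {A : Type*} [CommRing A] (h : IsRealRing A) : IsReduced A :=
  isReduced_iff_pow_one_lt 2 one_lt_two |>.mpr fun _ ha => h.eq_zero_of_sq ha

theorem IsRealRing.of_injective {A B : Type*} [CommRing A] [CommRing B] (h : IsRealRing B)
    (f : A →+* B) (hf : Function.Injective f) : IsRealRing A := by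
  intro n g hg i
  apply hf
  rw [map_zero]
  exact h n (fun i => f (g i)) (by simpa using congrArg f hg) i

theorem IsRealRing.pi {ι : Type*} {R : ι → Type*} [∀ i, CommRing (R i)]
    (h : ∀ i, IsRealRing (R i)) : IsRealRing (∀ i, R i) := by
  intro n g hg i
  funext p
  exact h p n (fun i => g i p) (by simpa using congrFun hg p) i

theorem IsVonNeumannRegular.isReduced {A : Type*} [CommRing A] (h : IsVonNeumannRegular A) :
    IsReduced A := by
  refine isReduced_iff_pow_one_lt 2 one_lt_two |>.mpr fun a ha => ?_
  obtain ⟨b, hb⟩ := h a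
  rw [hb, ha, zero_mul]

theorem IsVonNeumannRegular.isMaximal {A : Type*} [CommRing A] (h : IsVonNeumannRegular A)
    (p : Ideal A) [hp : p.IsPrime] : p.IsMaximal := by
  refine Ideal.isMaximal_iff.mpr ⟨p.ne_top_iff_one.mp hp.ne_top, fun J x hpJ hxp hxJ => ?_⟩
  obtain ⟨y, hy⟩ := h x
  have h1 : x * (1 - x * y) ∈ p := by
    have : x * (1 - x * y) = 0 := by linear_combination hy
    simp [this]
  have h2 : 1 - x * y ∈ J := hpJ ((hp.mem_or_mem h1).resolve_left hxp)
  simpa using J.add_mem h2 (J.mul_mem_right y hxJ)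

theorem isVonNeumannRegular_of_isMaximal {B : Type*} [CommRing B] [IsReduced B]
    (h : ∀ q : Ideal B, q.IsPrime → q.IsMaximal) : IsVonNeumannRegular B := by
  intro b
  let M : Submonoid B :=
    { carrier := {z | ∃ (n : ℕ) (x : B), z = b ^ n * (1 - b * x)}
      one_mem' := ⟨0, 0, by simp⟩
      mul_mem' := by
        rintro _ _ ⟨n, x, rfl⟩ ⟨m, y, rfl⟩
        exact ⟨n + m, x + y - b * x * y, by ring⟩ }
  by_cases h0 : (0 : B) ∈ M
  · obtain ⟨n, x, hx⟩ := h0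
    refine ⟨x, ?_⟩
    have : (b * (1 - b * x)) ^ (n + 1) = 0 := by
      rw [mul_pow, pow_succ, pow_succ (1 - b * x)]
      linear_combination (-(b * (1 - b * x) ^ n)) * hx
    have := pow_eq_zero_iff (Nat.succ_ne_zero n) |>.mp this
    linear_combination this
  · obtain ⟨q, hq, -, hdisj⟩ := Ideal.exists_le_prime_disjoint (⊥ : Ideal B) M
      (by
        rw [Set.disjoint_left]
        rintro x hx hxM
        rw [SetLike.mem_coe, Ideal.mem_bot] at hx
        exact h0 (hx ▸ hxM))
    rw [Set.disjoint_left] at hdisj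
    have hbq : b ∉ q := fun hb => hdisj hb ⟨1, 0, by simp⟩
    obtain ⟨y, hy⟩ := (h q hq).exists_inv hbq
    obtain ⟨i, hi, hiq⟩ := hy
    refine absurd ⟨0, y, ?_⟩ (hdisj hi)
    rw [pow_zero, one_mul]
    linear_combination hiq

/-- A reduced integral extension of a von Neumann regular ring is von Neumann regular. -/
theorem IsVonNeumannRegular.of_isIntegral {A B : Type*} [CommRing A] [CommRing B] [IsReduced B]
    (h : IsVonNeumannRegular A) (f : A →+* B) (hf : f.IsIntegral) : IsVonNeumannRegular B :=
  isVonNeumannRegular_of_isMaximal fun q _ =>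
    Ideal.isMaximal_of_isIntegral_of_isMaximal_comap' f hf q (h.isMaximal _)

theorem IsVonNeumannRegular.exists_idempotent {A : Type*} [CommRing A]
    (h : IsVonNeumannRegular A) (a : A) : ∃ e c : A, e * e = e ∧ e = a * c ∧ a * e = a := by
  obtain ⟨b, hb⟩ := h a
  exact ⟨a * b, b, by linear_combination (-b) * hb, rfl, by linear_combination -hb⟩

/-- Residue rings of real von Neumann regular rings are real. -/
theorem IsRealRing.quotient {A : Type*} [CommRing A] (hr : IsRealRing A)
    (h : IsVonNeumannRegular A) (J : Ideal A) : IsRealRing (A ⧸ J) := by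
  intro n g hg i
  choose d hd using fun i => Ideal.Quotient.mk_surjective (g i)
  obtain ⟨e, c, he, hec, hse⟩ := h.exists_idempotent (∑ i, d i ^ 2)
  have hJ : ∑ i, d i ^ 2 ∈ J := by
    rw [← Ideal.Quotient.eq_zero_iff_mem, map_sum]
    simpa [hd] using hg
  have hz : ∑ i, ((1 - e) * d i) ^ 2 = 0 := by
    simp_rw [mul_pow, ← Finset.mul_sum]
    linear_combination (-(1 - e)) * hse
  have := hr n _ hz i
  rw [← hd i, Ideal.Quotient.eq_zero_iff_mem]
  have h2 : d i = (∑ i, d i ^ 2) * (c * d i) := by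
    rw [← mul_assoc, ← hec]; linear_combination this
  rw [h2]
  exact J.mul_mem_right _ hJ

/-- Every injective ring homomorphism becomes essential after dividing by a suitable ideal. -/
theorem exists_ideal_isEssentialExtension {A D : Type*} [CommRing A] [CommRing D] (f : A →+* D)
    (hf : Function.Injective f) :
    ∃ J : Ideal D, IsEssentialExtension ((Ideal.Quotient.mk J).comp f) := by
  obtain ⟨J, -, hJ⟩ := zorn_le_nonempty₀ {J : Ideal D | ∀ a, f a ∈ J → a = 0}
    (fun c hc hchain y hy => by
      refine ⟨sSup c, fun a ha => ?_, fun z hz => le_sSup hz⟩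
      obtain ⟨I, hI, haI⟩ := (Submodule.mem_sSup_of_directed ⟨y, hy⟩ hchain.directedOn).mp ha
      exact hc hI a haI) ⊥
    (fun a ha => hf (by simpa using ha))
  refine ⟨J, ?_, fun I hI => ?_⟩
  · rw [injective_iff_map_eq_zero]
    intro a ha
    exact hJ.prop a (Ideal.Quotient.eq_zero_iff_mem.mp ha)
  · by_contra! hcon
    have hle : J ≤ I.comap (Ideal.Quotient.mk J) := by
      intro x hx
      rw [Ideal.mem_comap, Ideal.Quotient.eq_zero_iff_mem.mpr hx]
      exact I.zero_mem
    have hmem : I.comap (Ideal.Quotient.mk J) ∈ {J : Ideal D | ∀ a, f a ∈ J → a = 0} := by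
      intro a ha
      exact hJ.prop a (Ideal.Quotient.eq_zero_iff_mem.mp (hcon a ha))
    have heq := hJ.eq_of_le hmem hle
    apply hI
    rw [eq_bot_iff]
    intro x hx
    obtain ⟨y, rfl⟩ := Ideal.Quotient.mk_surjective x
    rw [Ideal.mem_bot, Ideal.Quotient.eq_zero_iff_mem, heq]
    exact hx

theorem IsEssentialExtension.of_comp {A B D : Type*} [CommRing A] [CommRing B] [CommRing D]
    {f : A →+* B} {g : B →+* D} (hf : IsEssentialExtension f)
    (hgf : IsEssentialExtension (g.comp f)) : IsEssentialExtension g := by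
  constructor
  · rw [RingHom.injective_iff_ker_eq_bot]
    by_contra hk
    obtain ⟨a, ha, ha0⟩ := hf.2 _ hk
    have : a = 0 := hgf.1 (by simpa using ha)
    exact ha0 (by rw [this, map_zero])
  · intro J hJ
    obtain ⟨a, ha, ha0⟩ := hgf.2 J hJ
    exact ⟨f a, ha, ha0⟩

theorem IsEssentialExtension.comp {A B D : Type*} [CommRing A] [CommRing B] [CommRing D]
    {f : A →+* B} {g : B →+* D} (hf : IsEssentialExtension f)
    (hg : IsEssentialExtension g) : IsEssentialExtension (g.comp f) := by
  refine ⟨hg.1.comp hf.1, fun J hJ => ?_⟩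
  obtain ⟨b, hb, hb0⟩ := hg.2 J hJ
  obtain ⟨a, ha, ha0⟩ := hf.2 (J.comap g) (fun h => hb0 (by
    have : b ∈ J.comap g := hb
    rw [h, Ideal.mem_bot] at this
    rw [this, map_zero]))
  exact ⟨a, ha, fun h => ha0 (hg.1 (by simpa using h))⟩

/-- The cone generated, in an intermediate field `S`, by a set `T` of elements of the base field
and the squares of `S`. -/
def IntermediateField.cone {F L : Type*} [Field F] [Field L] [Algebra F L] (T : Set F)
    (S : IntermediateField F L) : AddSubmonoid L :=
  AddSubmonoid.closure {x | ∃ t ∈ T, ∃ s ∈ S, x = algebraMap F L t * s ^ 2}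

namespace IntermediateField

variable {F L : Type*} [Field F] [Field L] [Algebra F L] {T : Set F}

theorem cone_le {S : IntermediateField F L} {x : L} (hx : x ∈ S.cone T) : x ∈ S := by
  refine AddSubmonoid.closure_induction ?_ S.zero_mem (fun _ _ _ _ h1 h2 => S.add_mem h1 h2) hx
  rintro _ ⟨t, -, s, hs, rfl⟩
  exact S.mul_mem (S.algebraMap_mem t) (pow_mem hs 2)

theorem cone_mono {S S' : IntermediateField F L} (h : S ≤ S') : S.cone T ≤ S'.cone T :=
  AddSubmonoid.closure_mono fun _ ⟨t, ht, s, hs, hx⟩ => ⟨t, ht, s, h hs, hx⟩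

theorem mul_mem_cone (hmul : ∀ a ∈ T, ∀ b ∈ T, a * b ∈ T) {S : IntermediateField F L} {x y : L}
    (hx : x ∈ S.cone T) (hy : y ∈ S.cone T) : x * y ∈ S.cone T := by
  refine AddSubmonoid.closure_induction ?_ (by simp) (fun a b _ _ h1 h2 => ?_) hx
  · rintro _ ⟨t, ht, s, hs, rfl⟩
    refine AddSubmonoid.closure_induction ?_ (by simp) (fun a b _ _ h1 h2 => ?_) hy
    · rintro _ ⟨t', ht', s', hs', rfl⟩
      refine AddSubmonoid.subset_closure ⟨t * t', hmul _ ht _ ht', s * s', S.mul_mem hs hs', ?_⟩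
      rw [map_mul]; ring
    · rw [mul_add]; exact add_mem h1 h2
  · rw [add_mul]; exact add_mem h1 h2

theorem sq_mem_cone (hone : (1 : F) ∈ T) {S : IntermediateField F L} {x : L} (hx : x ∈ S) :
    x ^ 2 ∈ S.cone T :=
  AddSubmonoid.subset_closure ⟨1, hone, x, hx, by simp⟩

theorem algebraMap_mem_cone {S : IntermediateField F L} {t : F} (ht : t ∈ T) :
    algebraMap F L t ∈ S.cone T :=
  AddSubmonoid.subset_closure ⟨t, ht, 1, S.one_mem, by simp⟩

theorem isPartialOrdering_cone (hmul : ∀ a ∈ T, ∀ b ∈ T, a * b ∈ T) (hone : (1 : F) ∈ T)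
    {S : IntermediateField F L} (hS : (-1 : L) ∉ S.cone T) :
    IsPartialOrdering {x : S | (x : L) ∈ S.cone T} := by
  refine ⟨fun a ha b hb => (S.cone T).add_mem ha hb,
    fun a ha b hb => mul_mem_cone hmul ha hb, fun a => sq_mem_cone hone a.2, fun a ha hna => ?_⟩
  by_contra h
  have h0 : (a : L) ≠ 0 := fun h' => h (Subtype.ext h')
  apply hS
  have := mul_mem_cone hmul (mul_mem_cone hmul ha hna) (sq_mem_cone hone (S.inv_mem a.2))
  convert this using 1
  push_cast
  field_simp

/-- A maximal intermediate field on which the cone generated by `T` stays proper. -/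
theorem exists_maximal_cone (hadd : ∀ a ∈ T, ∀ b ∈ T, a + b ∈ T)
    (hmul : ∀ a ∈ T, ∀ b ∈ T, a * b ∈ T) (hsq : ∀ a : F, a ^ 2 ∈ T) (hneg : (-1 : F) ∉ T) :
    ∃ S : IntermediateField F L, Maximal (fun S => (-1 : L) ∉ S.cone T) S := by
  obtain ⟨S, -, hS⟩ := zorn_le_nonempty₀ {S : IntermediateField F L | (-1 : L) ∉ S.cone T}
    (fun c hc hchain S₀ hS₀ => by
      have : Nonempty c := ⟨⟨S₀, hS₀⟩⟩
      have hdir : Directed (· ≤ ·) (fun S : c => (S : IntermediateField F L)) :=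
        hchain.directed
      refine ⟨⨆ S : c, (S : IntermediateField F L), fun hmem => ?_,
        fun z hz => le_iSup (fun S : c => (S : IntermediateField F L)) ⟨z, hz⟩⟩
      have key : ∀ x ∈ (⨆ S : c, (S : IntermediateField F L)).cone T,
          ∃ S : c, x ∈ (S : IntermediateField F L).cone T := by
        intro x hx
        refine AddSubmonoid.closure_induction ?_ ⟨⟨S₀, hS₀⟩, zero_mem _⟩ ?_ hx
        · rintro _ ⟨t, ht, s, hs, rfl⟩
          have hs' : s ∈ ((⨆ S : c, (S : IntermediateField F L) : IntermediateField F L) :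
            Set L) := hs
          rw [coe_iSup_of_directed hdir, Set.mem_iUnion] at hs'
          obtain ⟨S, hsS⟩ := hs'
          exact ⟨S, AddSubmonoid.subset_closure ⟨t, ht, s, hsS, rfl⟩⟩
        · rintro a b - - ⟨S₁, h₁⟩ ⟨S₂, h₂⟩
          obtain ⟨S₃, h₁₃, h₂₃⟩ := hdir S₁ S₂
          exact ⟨S₃, add_mem (cone_mono h₁₃ h₁) (cone_mono h₂₃ h₂)⟩
      obtain ⟨S, hS⟩ := key _ hmem
      exact hc S.2 hS) ⊥
    (by
      intro h
      have key : ∀ x ∈ (⊥ : IntermediateField F L).cone T, ∃ t ∈ T, x = algebraMap F L t := by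
        intro x hx
        refine AddSubmonoid.closure_induction ?_ ⟨0, by simpa using hsq 0, by simp⟩ ?_ hx
        · rintro _ ⟨t, ht, s, hs, rfl⟩
          obtain ⟨u, rfl⟩ := mem_bot.mp hs
          exact ⟨t * u ^ 2, hmul _ ht _ (hsq u), by simp⟩
        · rintro _ _ - - ⟨t, ht, rfl⟩ ⟨u, hu, rfl⟩
          exact ⟨t + u, hadd _ ht _ hu, by simp⟩
      obtain ⟨t, ht, h⟩ := key _ h
      apply hneg
      have : t = -1 := (algebraMap F L).injective (by rw [← h]; simp)
      rwa [← this])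
  exact ⟨S, hS⟩

theorem exists_add_mul_of_mem_adjoin_sqrt {R L : Type*} [Field R] [Field L] [Algebra R L] {x : R}
    {y : L} (hy : y ^ 2 = algebraMap R L x) {z : L} (hz : z ∈ R⟮y⟯) :
    ∃ a b : R, z = algebraMap R L a + algebraMap R L b * y := by
  have hint : IsIntegral R y := IsIntegral.of_pow two_pos (hy ▸ isIntegral_algebraMap)
  rw [← mem_toSubalgebra, adjoin_simple_toSubalgebra_of_isAlgebraic hint.isAlgebraic] at hz
  induction hz using Algebra.adjoin_induction with
  | mem w hw => exact ⟨0, 1, by simpa using hw⟩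
  | algebraMap r => exact ⟨r, 0, by simp⟩
  | add u v _ _ hu hv =>
    obtain ⟨a, b, rfl⟩ := hu
    obtain ⟨c, d, rfl⟩ := hv
    exact ⟨a + c, b + d, by simp only [map_add]; ring⟩
  | mul u v _ _ hu hv =>
    obtain ⟨a, b, rfl⟩ := hu
    obtain ⟨c, d, rfl⟩ := hv
    refine ⟨a * c + b * d * x, a * d + b * c, ?_⟩
    simp only [map_add, map_mul]
    linear_combination algebraMap R L b * algebraMap R L d * hy

theorem neg_one_mem_cone_adjoin
    {S : IntermediateField F L} (hS : Maximal (fun S => (-1 : L) ∉ S.cone T) S)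
    {y : L} (hy : y ∉ S) :
    (-1 : L) ∈ (S⟮y⟯.restrictScalars F).cone T := by
  by_contra hcon
  have hle : S ≤ S⟮y⟯.restrictScalars F := fun z hz => S⟮y⟯.algebraMap_mem ⟨z, hz⟩
  exact hy (hS.le_of_ge hcon hle (mem_adjoin_simple_self S y))

variable [IsAlgClosed L]

theorem neg_mem_cone_of_not_sq
    (hmul : ∀ a ∈ T, ∀ b ∈ T, a * b ∈ T) (hone : (1 : F) ∈ T) {S : IntermediateField F L}
    (hS : Maximal (fun S => (-1 : L) ∉ S.cone T) S)
    {x : S} (hx : ¬ ∃ y : S, y ^ 2 = x) : (-x : L) ∈ S.cone T := by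
  obtain ⟨y, hy⟩ := IsAlgClosed.exists_pow_nat_eq (x : L) two_pos
  have hyS : y ∉ S := fun h => hx ⟨⟨y, h⟩, Subtype.ext hy⟩
  have key : ∀ z ∈ (S⟮y⟯.restrictScalars F).cone T,
      ∃ u ∈ S.cone T, ∃ v ∈ S.cone T, ∃ w ∈ S, z = u + x * v + w * y := by
    intro z hz
    refine AddSubmonoid.closure_induction ?_
      ⟨0, zero_mem _, 0, zero_mem _, 0, zero_mem _, by simp⟩ ?_ hz
    · rintro _ ⟨t, ht, s, hs, rfl⟩
      obtain ⟨a, b, rfl⟩ := exists_add_mul_of_mem_adjoin_sqrt (x := x) hy hs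
      refine ⟨algebraMap F L t * a ^ 2, AddSubmonoid.subset_closure ⟨t, ht, a, a.2, rfl⟩,
        algebraMap F L t * b ^ 2, AddSubmonoid.subset_closure ⟨t, ht, b, b.2, rfl⟩,
        algebraMap F L t * 2 * a * b, ?_, ?_⟩
      · exact S.mul_mem (S.mul_mem (S.mul_mem (S.algebraMap_mem t) (ofNat_mem S 2)) a.2) b.2
      · simp only [algebraMap_apply]
        linear_combination algebraMap F L t * b ^ 2 * hy
    · rintro _ _ - - ⟨u, hu, v, hv, w, hw, rfl⟩ ⟨u', hu', v', hv', w', hw', rfl⟩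
      exact ⟨u + u', add_mem hu hu', v + v', add_mem hv hv', w + w', add_mem hw hw', by ring⟩
  obtain ⟨u, hu, v, hv, w, hw, h⟩ := key _ (neg_one_mem_cone_adjoin hS hyS)
  have hw0 : w = 0 := by
    by_contra hw0
    apply hyS
    have : y = w⁻¹ * (-1 - u - x * v) := by
      field_simp
      linear_combination -h
    rw [this]
    exact S.mul_mem (S.inv_mem hw) (S.sub_mem (S.sub_mem (S.neg_mem S.one_mem) (cone_le hu))
      (S.mul_mem x.2 (cone_le hv)))
  subst hw0
  have hv0 : v ≠ 0 := by
    rintro rfl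
    apply hS.prop
    simpa [h] using hu
  have h1 : (-x : L) = (1 + u) * v * v⁻¹ ^ 2 := by
    field_simp
    linear_combination h
  rw [h1]
  exact mul_mem_cone hmul (mul_mem_cone hmul
    (add_mem (by simpa using algebraMap_mem_cone (L := L) hone) hu) hv)
    (sq_mem_cone hone (S.inv_mem (cone_le hv)))

theorem exists_sq_of_mem_cone
    (hmul : ∀ a ∈ T, ∀ b ∈ T, a * b ∈ T) (hone : (1 : F) ∈ T) {S : IntermediateField F L}
    (hS : Maximal (fun S => (-1 : L) ∉ S.cone T) S)
    {x : S} (hx : (x : L) ∈ S.cone T) : ∃ y : S, y ^ 2 = x := by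
  by_contra hcon
  have h0 := (isPartialOrdering_cone hmul hone hS.prop).2.2.2 x hx
    (by simpa using neg_mem_cone_of_not_sq hmul hone hS hcon)
  exact hcon ⟨0, by simp [h0]⟩

theorem exists_sq_or_exists_sq_neg
    (hmul : ∀ a ∈ T, ∀ b ∈ T, a * b ∈ T) (hone : (1 : F) ∈ T) {S : IntermediateField F L}
    (hS : Maximal (fun S => (-1 : L) ∉ S.cone T) S)
    (x : S) : (∃ y : S, y ^ 2 = x) ∨ ∃ y : S, y ^ 2 = -x := by
  by_cases h : ∃ y : S, y ^ 2 = x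
  · exact Or.inl h
  · refine Or.inr (exists_sq_of_mem_cone hmul hone hS ?_)
    simpa using neg_mem_cone_of_not_sq hmul hone hS h

end IntermediateField

/-- Over a real field in which sums of two squares are squares, the polynomials of even degree
less than `2 * n - 1` whose leading coefficient is a square are closed under addition. -/
theorem Polynomial.even_natDegree_add_of_leadingCoeff_sq {R : Type*} [Field R] (hR : IsRealRing R)
    (hadd : ∀ a b : R, ∃ c, c ^ 2 = a ^ 2 + b ^ 2) {n : ℕ} {G H : R[X]}
    (hG : Even G.natDegree ∧ G.natDegree + 2 ≤ 2 * n ∧ ∃ c, c ^ 2 = G.leadingCoeff)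
    (hH : Even H.natDegree ∧ H.natDegree + 2 ≤ 2 * n ∧ ∃ c, c ^ 2 = H.leadingCoeff) :
    Even (G + H).natDegree ∧ (G + H).natDegree + 2 ≤ 2 * n ∧
      ∃ c, c ^ 2 = (G + H).leadingCoeff := by
  rcases lt_trichotomy G.degree H.degree with h | h | h
  · rw [natDegree_add_eq_right_of_degree_lt h, leadingCoeff_add_of_degree_lt h]
    exact hH
  · obtain ⟨hG1, hG2, a, ha⟩ := hG
    obtain ⟨-, -, b, hb⟩ := hH
    by_cases hz : G.leadingCoeff + H.leadingCoeff = 0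
    · have : G = 0 := by
        rw [← leadingCoeff_eq_zero, ← ha,
          (hR.sq_add_sq (a := a) (b := b) (by rw [ha, hb, hz])).1, zero_pow two_ne_zero]
      subst this
      have : H = 0 := by simpa using h.symm
      subst this
      exact ⟨by simp, by simpa using hG2, 0, by simp⟩
    · obtain ⟨c, hc⟩ := hadd a b
      have hd : (G + H).degree = G.degree := by
        rw [degree_add_eq_of_leadingCoeff_add_ne_zero hz, h, max_self]
      rw [leadingCoeff_add_of_degree_eq h hz, natDegree_eq_of_degree_eq hd]
      exact ⟨hG1, hG2, c, by rw [hc, ha, hb]⟩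
  · rw [natDegree_add_eq_left_of_degree_lt h, leadingCoeff_add_of_degree_lt' h]
    exact hG

namespace IntermediateField

variable {F L : Type*} [Field F] [Field L] [Algebra F L] {T : Set F}
  [IsAlgClosed L]

theorem exists_root_of_odd_natDegree
    (hmul : ∀ a ∈ T, ∀ b ∈ T, a * b ∈ T) (hone : (1 : F) ∈ T) {S : IntermediateField F L}
    (hS : Maximal (fun S => (-1 : L) ∉ S.cone T) S)
    (n : ℕ) :
    ∀ f : S[X], f.natDegree = n → Odd n → ∃ x : S, eval x f = 0 := by
  have hreal : IsRealRing S := (isPartialOrdering_cone hmul hone hS.prop).isRealRing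
  have hadd : ∀ a b : S, ∃ c, c ^ 2 = a ^ 2 + b ^ 2 := fun a b =>
    exists_sq_of_mem_cone hmul hone hS
      (add_mem (sq_mem_cone hone a.2) (sq_mem_cone hone b.2))
  induction n using Nat.strong_induction_on with
  | _ n ih =>
  intro f hfn hodd
  have hn0 : n ≠ 0 := by rintro rfl; simp at hodd
  have hf0 : f ≠ 0 := by rintro rfl; exact hn0 (by simpa using hfn.symm)
  have hfu : ¬ IsUnit f := fun h => hn0 (hfn ▸ natDegree_eq_zero_of_isUnit h)
  by_cases hirr : Irreducible f
  · obtain ⟨θ, hθ⟩ := IsAlgClosed.exists_aeval_eq_zero L f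
      (fun h => hn0 (hfn ▸ natDegree_eq_zero_iff_degree_le_zero.mpr h.le))
    by_cases hθS : θ ∈ S
    · refine ⟨⟨θ, hθS⟩, Subtype.ext ?_⟩
      have : aeval (algebraMap S L ⟨θ, hθS⟩) f = 0 := hθ
      rw [aeval_algebraMap_apply] at this
      simpa using this
    have halg : IsAlgebraic S θ := ⟨f, hf0, hθ⟩
    have key : ∀ z ∈ (S⟮θ⟯.restrictScalars F).cone T, ∃ G : S[X], z = aeval θ G ∧
        (Even G.natDegree ∧ G.natDegree + 2 ≤ 2 * n ∧ ∃ c, c ^ 2 = G.leadingCoeff) ∧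
        ∀ a, ∃ c, c ^ 2 = eval a G := by
      intro z hz
      refine AddSubmonoid.closure_induction ?_ ⟨0, by simp, ⟨by simp, ?_, 0, by simp⟩,
        fun a => ⟨0, by simp⟩⟩ ?_ hz
      · rintro _ ⟨t, ht, s, hs, rfl⟩
        obtain ⟨r, hr⟩ := exists_sq_of_mem_cone hmul hone hS (x := algebraMap F S t)
          (algebraMap_mem_cone ht)
        rw [mem_restrictScalars, ← mem_toSubalgebra,
          adjoin_simple_toSubalgebra_of_isAlgebraic halg,
          Algebra.adjoin_singleton_eq_range_aeval] at hs
        obtain ⟨g, rfl⟩ := hs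
        have hg : aeval θ (g % f) = aeval θ g := by
          conv_rhs => rw [← EuclideanDomain.div_add_mod g f]
          simp [hθ]
        have hlt : (g % f).natDegree < n := hfn ▸ natDegree_mod_lt g (hfn ▸ hn0)
        have hle : (C r * (g % f)).natDegree ≤ (g % f).natDegree := natDegree_C_mul_le _ _
        refine ⟨(C r * (g % f)) ^ 2, ?_, ⟨?_, ?_, _, (leadingCoeff_pow _ _).symm⟩,
          fun a => ⟨_, (eval_pow _).symm⟩⟩
        · rw [map_pow, map_mul, hg, aeval_C, mul_pow, ← map_pow (algebraMap S L), hr]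
          rfl
        · rw [natDegree_pow]; exact even_two_mul _
        · rw [natDegree_pow]; omega
      · rw [natDegree_zero]; omega
      · rintro _ _ - - ⟨G, rfl, hG, hG'⟩ ⟨H, rfl, hH, hH'⟩
        refine ⟨G + H, by simp, even_natDegree_add_of_leadingCoeff_sq hreal hadd hG hH,
          fun a => ?_⟩
        obtain ⟨c, hc⟩ := hG' a
        obtain ⟨d, hd⟩ := hH' a
        obtain ⟨e, he⟩ := hadd c d
        exact ⟨e, by rw [he, hc, hd, eval_add]⟩
    obtain ⟨G, hG, hG1, hG2⟩ := key _ (neg_one_mem_cone_adjoin hS hθS)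
    obtain ⟨heven, hle, -⟩ := even_natDegree_add_of_leadingCoeff_sq hreal hadd (n := n) (G := 1)
      ⟨by simp, by rw [natDegree_one]; omega, 1, by simp⟩ hG1
    have hdvd : f ∣ 1 + G := ((minpoly.irreducible halg.isIntegral).dvd_symm hirr
      (minpoly.dvd S θ hθ)).trans (minpoly.dvd S θ (by simp [← hG]))
    obtain ⟨h, hh⟩ := hdvd
    have hne : ∀ a, eval a (1 + G) ≠ 0 := by
      intro a ha
      obtain ⟨c, hc⟩ := hG2 a
      have := (hreal.sq_add_sq (a := 1) (b := c) (by rw [hc]; simpa using ha)).1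
      exact one_ne_zero this
    have hh0 : h ≠ 0 := by
      rintro rfl
      exact hne 0 (by rw [hh]; simp)
    rw [hh, natDegree_mul hf0 hh0, hfn] at heven hle
    have hhodd : Odd h.natDegree := by
      by_contra hcon
      rw [Nat.not_odd_iff_even] at hcon
      exact Nat.not_even_iff_odd.mpr hodd ((Nat.even_add.mp heven).mpr hcon)
    obtain ⟨a, ha⟩ := ih h.natDegree (by omega) h rfl hhodd
    exact absurd (by rw [hh, eval_mul, ha, mul_zero]) (hne a)
  · rw [irreducible_iff, not_and_or, or_iff_right (not_not.mpr hfu)] at hirr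
    push Not at hirr
    obtain ⟨g, h, rfl, hg, hh⟩ := hirr
    have hg0 : g ≠ 0 := left_ne_zero_of_mul hf0
    have hh0 : h ≠ 0 := right_ne_zero_of_mul hf0
    have hgd : 0 < g.natDegree :=
      natDegree_pos_iff_degree_pos.mpr (degree_pos_of_ne_zero_of_nonunit hg0 hg)
    have hhd : 0 < h.natDegree :=
      natDegree_pos_iff_degree_pos.mpr (degree_pos_of_ne_zero_of_nonunit hh0 hh)
    rw [natDegree_mul hg0 hh0] at hfn
    rw [← hfn, Nat.odd_add] at hodd
    by_cases hgo : Odd g.natDegree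
    · obtain ⟨a, ha⟩ := ih g.natDegree (by omega) g rfl hgo
      exact ⟨a, by rw [eval_mul, ha, zero_mul]⟩
    · obtain ⟨a, ha⟩ := ih h.natDegree (by omega) h rfl
        (by rw [← Nat.not_even_iff_odd]; exact fun h' => hgo (hodd.mpr h'))
      exact ⟨a, by rw [eval_mul, ha, mul_zero]⟩

theorem isRealClosedField_of_maximal_cone
    (hmul : ∀ a ∈ T, ∀ b ∈ T, a * b ∈ T) (hone : (1 : F) ∈ T) {S : IntermediateField F L}
    (hS : Maximal (fun S => (-1 : L) ∉ S.cone T) S) : IsRealClosedField S :=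
  ⟨(isPartialOrdering_cone hmul hone hS.prop).isRealRing,
    exists_sq_or_exists_sq_neg hmul hone hS,
    fun p hp => exists_root_of_odd_natDegree hmul hone hS _ p rfl hp⟩

end IntermediateField

/-- A field with a proper preordering `T` has an algebraic real closed extension field in which
all elements of `T` become squares. -/
theorem exists_isRealClosedField {F : Type u} [Field F] {T : Set F}
    (hadd : ∀ a ∈ T, ∀ b ∈ T, a + b ∈ T) (hmul : ∀ a ∈ T, ∀ b ∈ T, a * b ∈ T)
    (hsq : ∀ a : F, a ^ 2 ∈ T) (hneg : (-1 : F) ∉ T) :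
    ∃ (R : Type u) (_ : Field R) (_ : Algebra F R), Algebra.IsAlgebraic F R ∧
      IsRealClosedField R ∧ ∀ t ∈ T, ∃ y : R, y ^ 2 = algebraMap F R t := by
  obtain ⟨S, hS⟩ := IntermediateField.exists_maximal_cone (L := AlgebraicClosure F)
    hadd hmul hsq hneg
  have hone : (1 : F) ∈ T := by simpa using hsq 1
  exact ⟨S, inferInstance, inferInstance, inferInstance,
    IntermediateField.isRealClosedField_of_maximal_cone hmul hone hS,
    fun t ht => IntermediateField.exists_sq_of_mem_cone hmul hone hS
      (IntermediateField.algebraMap_mem_cone ht)⟩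

theorem IsRealRing.charZero {A : Type*} [CommRing A] [Nontrivial A] (h : IsRealRing A) :
    CharZero A :=
  charZero_of_inj_zero fun n hn => by
    cases n with
    | zero => rfl
    | succ n => exact absurd (h (n + 1) (fun _ => 1) (by simpa using hn) 0) one_ne_zero

section RealClosed

variable {R : Type u} [Field R]

theorem IsRealClosedField.exists_sq_eq_sq_add_sq (hR : IsRealClosedField R) (a b : R) :
    ∃ c, c ^ 2 = a ^ 2 + b ^ 2 := by
  obtain ⟨c, hc⟩ | ⟨c, hc⟩ := hR.2.1 (a ^ 2 + b ^ 2)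
  · exact ⟨c, hc⟩
  · have := hR.1 3 ![a, b, c] (by simp [Fin.sum_univ_succ]; linear_combination hc)
    have ha : a = 0 := this 0
    have hb : b = 0 := this 1
    exact ⟨0, by simp [ha, hb]⟩

theorem IsRealClosedField.exists_sq_complex (hR : IsRealClosedField R) {Ω : Type*} [CommRing Ω]
    [Algebra R Ω] {i : Ω} (hi : i ^ 2 = -1) (a b : R) :
    ∃ c d : R, (algebraMap R Ω c + algebraMap R Ω d * i) ^ 2 =
      algebraMap R Ω a + algebraMap R Ω b * i := by
  have := hR.1.charZero
  suffices ∃ c d : R, c ^ 2 - d ^ 2 = a ∧ 2 * c * d = b by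
    obtain ⟨c, d, rfl, rfl⟩ := this
    refine ⟨c, d, ?_⟩
    simp only [map_sub, map_mul, map_pow, map_ofNat]
    linear_combination (algebraMap R Ω d) ^ 2 * hi
  by_cases hb : b = 0
  · obtain ⟨c, hc⟩ | ⟨c, hc⟩ := hR.2.1 a
    · exact ⟨c, 0, by simp [hc], by simp [hb]⟩
    · exact ⟨0, c, by simp [hc], by simp [hb]⟩
  obtain ⟨r, hr⟩ := hR.exists_sq_eq_sq_add_sq a b
  have key : ∀ s : R, s ^ 2 = a ^ 2 + b ^ 2 → (∃ c, c ^ 2 = (s + a) / 2) →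
      ∃ c d : R, c ^ 2 - d ^ 2 = a ∧ 2 * c * d = b := by
    rintro s hs ⟨c, hc⟩
    have hc0 : c ≠ 0 := by
      rintro rfl
      apply hb
      have h1 : s = -a := by linear_combination -2 * hc
      exact pow_eq_zero_iff two_ne_zero |>.mp (by rw [h1] at hs; linear_combination -hs)
    refine ⟨c, b / (2 * c), ?_, by field_simp⟩
    have h2 : s = 2 * c ^ 2 - a := by linear_combination -2 * hc
    field_simp
    rw [h2] at hs
    linear_combination hs
  obtain h | ⟨u, hu⟩ := hR.2.1 ((r + a) / 2)
  · exact key r hr h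
  obtain h | ⟨v, hv⟩ := hR.2.1 ((-r + a) / 2)
  · exact key (-r) (by rw [neg_sq, hr]) h
  have h4 : (2 * u * v) ^ 2 + b ^ 2 = 0 := by
    have : (2 * u * v) ^ 2 = 4 * (u ^ 2) * (v ^ 2) := by ring
    rw [this, hu, hv]
    linear_combination -hr
  exact absurd (hR.1.sq_add_sq h4).2 hb

theorem IsRealClosedField.finrank_eq_one_of_odd (hR : IsRealClosedField R) (K : Type*) [Field K]
    [Algebra R K] [FiniteDimensional R K] (hodd : Odd (Module.finrank R K)) :
    Module.finrank R K = 1 := by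
  have := hR.1.charZero
  obtain ⟨x, hx⟩ := Field.exists_primitive_element R K
  have hdeg := (Field.primitive_element_iff_minpoly_natDegree_eq R x).mp hx
  obtain ⟨r, hr⟩ := hR.2.2 (minpoly R x) (by rwa [hdeg])
  rw [← hdeg]
  exact natDegree_eq_of_degree_eq_some (degree_eq_one_of_irreducible_of_root
    (minpoly.irreducible (Algebra.IsIntegral.isIntegral x)) hr)

end RealClosed

theorem IsGalois.algebraMap_surjective_of_finrank_eq_two_pow {M E : Type*} [Field M] [Field E]
    [Algebra M E] [FiniteDimensional M E] [IsGalois M E] (h2 : (2 : E) ≠ 0)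
    (hsq : ∀ x : M, ∃ y, y ^ 2 = x) {m : ℕ} (hm : Module.finrank M E = 2 ^ m) :
    Function.Surjective (algebraMap M E) := by
  have hcard : Nat.card Gal(E/M) = 2 ^ m := by rw [IsGalois.card_aut_eq_finrank, hm]
  cases m with
  | zero =>
    rw [pow_zero] at hm
    intro x
    have h1 : (⊥ : Subalgebra M E) = ⊤ := Subalgebra.bot_eq_top_of_finrank_eq_one hm
    have : x ∈ (⊥ : Subalgebra M E) := h1 ▸ Algebra.mem_top
    exact Algebra.mem_bot.mp this
  | succ m =>
    exfalso
    have : Fact (Nat.Prime 2) := ⟨Nat.prime_two⟩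
    obtain ⟨K, hK⟩ := Sylow.exists_subgroup_card_pow_prime (G := Gal(E/M)) 2 (n := m)
      (by rw [hcard]; exact pow_dvd_pow _ (Nat.le_succ m))
    have hidx : K.index = 2 := by
      have := K.card_mul_index
      rw [hK, hcard, pow_succ] at this
      exact Nat.eq_of_mul_eq_mul_left (by positivity) this
    have hKtop : K ≠ ⊤ := by
      rintro rfl
      simp at hidx
    have hfix : IntermediateField.fixedField K ≠ ⊥ := by
      intro h
      apply hKtop
      rw [← IntermediateField.fixingSubgroup_fixedField K, h, IntermediateField.fixingSubgroup_bot]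
    obtain ⟨h, hh⟩ : ∃ h, h ∉ K := by
      by_contra! hcon
      exact hKtop (eq_top_iff.mpr fun x _ => hcon x)
    apply hfix
    rw [eq_bot_iff]
    intro y hy
    rw [IntermediateField.mem_fixedField_iff] at hy
    have hmul : ∀ a b : Gal(E/M), a ∉ K → b ∉ K → a * b ∈ K := fun a b ha hb =>
      (Subgroup.mul_mem_iff_of_index_two hidx).mpr (by simp [ha, hb])
    have hhy : ∀ g ∉ K, g y = h y := by
      intro g hg
      have := hy _ (hmul h⁻¹ g (by simpa using hh) hg)
      rw [AlgEquiv.mul_apply] at this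
      conv_rhs => rw [← this]
      simp [← AlgEquiv.mul_apply]
    have hgh : ∀ g ∈ K, g (h y) = h y := fun g hg => by
      rw [← AlgEquiv.mul_apply]
      exact hhy _ (by rwa [K.mul_mem_cancel_left hg])
    have hgh' : ∀ g ∉ K, g (h y) = y := fun g hg => by
      rw [← AlgEquiv.mul_apply]
      exact hy _ (hmul _ _ hg hh)
    have hbot : ∀ z : E, (∀ g : Gal(E/M), g z = z) → ∃ w, algebraMap M E w = z := fun z hz =>
      (IsGalois.mem_range_algebraMap_iff_fixed z).mpr hz
    obtain ⟨s, hs⟩ := hbot (y + h y) fun g => by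
      by_cases hg : g ∈ K
      · rw [map_add, hy g hg, hgh g hg]
      · rw [map_add, hhy g hg, hgh' g hg, add_comm]
    obtain ⟨d, hd⟩ := hbot ((y - h y) ^ 2) fun g => by
      by_cases hg : g ∈ K
      · rw [map_pow, map_sub, hy g hg, hgh g hg]
      · rw [map_pow, map_sub, hhy g hg, hgh' g hg]; ring
    obtain ⟨c, rfl⟩ := hsq d
    rw [map_pow, sq_eq_sq_iff_eq_or_eq_neg] at hd
    rw [IntermediateField.mem_bot]
    obtain hd | hd := hd
    · refine ⟨(s + c) / 2, ?_⟩
      rw [map_div₀, map_add, hs, hd, map_ofNat]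
      field_simp
      ring
    · refine ⟨(s - c) / 2, ?_⟩
      rw [map_div₀, map_sub, hs, hd, map_ofNat]
      field_simp
      ring

theorem IsRealClosedField.exists_eq_add_mul {R : Type u} [Field R] (hR : IsRealClosedField R)
    {Ω : Type*} [Field Ω] [Algebra R Ω] [IsAlgClosure R Ω] {i : Ω} (hi : i ^ 2 = -1) (z : Ω) :
    ∃ a b : R, z = algebraMap R Ω a + algebraMap R Ω b * i := by
  have := hR.1.charZero
  have : Algebra.IsAlgebraic R Ω := IsAlgClosure.isAlgebraic
  have : IsAlgClosed Ω := IsAlgClosure.isAlgClosed R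
  have : CharZero Ω := charZero_of_injective_algebraMap (algebraMap R Ω).injective
  have : Fact (Nat.Prime 2) := ⟨Nat.prime_two⟩
  let N : IntermediateField R Ω := IntermediateField.adjoin R {z, i}
  have : FiniteDimensional R N := IntermediateField.finiteDimensional_adjoin fun x _ =>
    Algebra.IsIntegral.isIntegral x
  let E : IntermediateField R Ω := IntermediateField.normalClosure R N Ω
  have hNE : N ≤ E := N.le_normalClosure
  have hzE : z ∈ E := hNE (IntermediateField.subset_adjoin R _ (by simp))
  have hiE : i ∈ E := hNE (IntermediateField.subset_adjoin R _ (by simp))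
  have : IsGalois R E := ⟨⟩
  have hGcard : Nat.card Gal(E/R) = Module.finrank R E := IsGalois.card_aut_eq_finrank R E
  obtain ⟨P⟩ : Nonempty (Sylow 2 Gal(E/R)) := inferInstance
  obtain ⟨k, hk⟩ := P.2.exists_card_eq
  have hfin : Module.finrank R (IntermediateField.fixedField P.1) = P.1.index := by
    rw [IntermediateField.finrank_eq_fixingSubgroup_index,
      IntermediateField.fixingSubgroup_fixedField]
  have hidx : P.1.index = 1 := by
    rw [← hfin]
    apply hR.finrank_eq_one_of_odd
    rw [hfin, ← Nat.not_even_iff_odd, even_iff_two_dvd]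
    exact P.not_dvd_index
  have hER : Module.finrank R E = 2 ^ k := by
    rw [← hGcard, ← P.1.card_mul_index, hidx, mul_one, hk]
  let j : E := ⟨i, hiE⟩
  have hj : j ^ 2 = -1 := Subtype.ext hi
  let M : Subalgebra R E :=
    { carrier := {x | ∃ a b : R, x = algebraMap R E a + algebraMap R E b * j}
      mul_mem' := by
        rintro _ _ ⟨a, b, rfl⟩ ⟨c, d, rfl⟩
        refine ⟨a * c - b * d, a * d + b * c, ?_⟩
        simp only [map_sub, map_mul, map_add]
        linear_combination (algebraMap R E b) * (algebraMap R E d) * hj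
      add_mem' := by
        rintro _ _ ⟨a, b, rfl⟩ ⟨c, d, rfl⟩
        refine ⟨a + c, b + d, ?_⟩
        simp only [map_add]
        ring
      algebraMap_mem' := fun r => ⟨r, 0, by simp⟩ }
  let M' : IntermediateField R E := M.toIntermediateField' (by
    exact (Subalgebra.isField_of_algebraic M))
  have hsqM : ∀ x : M', ∃ y, y ^ 2 = x := by
    rintro ⟨x, a, b, rfl⟩
    obtain ⟨c, d, hcd⟩ := hR.exists_sq_complex hj a b
    exact ⟨⟨_, c, d, rfl⟩, Subtype.ext hcd⟩
  obtain ⟨m, -, hm⟩ := (Nat.dvd_prime_pow Nat.prime_two).mp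
    (⟨_, ((Module.finrank_mul_finrank R M' E).trans hER).symm.trans (mul_comm _ _)⟩ :
      Module.finrank M' E ∣ 2 ^ k)
  obtain ⟨⟨_, a, b, rfl⟩, hx⟩ := IsGalois.algebraMap_surjective_of_finrank_eq_two_pow
    two_ne_zero hsqM hm ⟨z, hzE⟩
  exact ⟨a, b, congrArg Subtype.val hx.symm⟩

section RealClosed

variable {R : Type u} [Field R] {Ω : Type*} [Field Ω] [Algebra R Ω] {i : Ω}

theorem IsRealRing.eq_zero_of_add_mul_eq_zero (hR : IsRealRing R) (hi : i ^ 2 = -1) {a b : R}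
    (h : algebraMap R Ω a + algebraMap R Ω b * i = 0) : a = 0 ∧ b = 0 := by
  refine hR.sq_add_sq ((algebraMap R Ω).injective ?_)
  rw [map_zero, map_add, map_pow, map_pow]
  linear_combination (algebraMap R Ω a - algebraMap R Ω b * i) * h + (algebraMap R Ω b) ^ 2 * hi

theorem IsRealRing.eq_of_add_mul_eq (hR : IsRealRing R) (hi : i ^ 2 = -1) {a b c d : R}
    (h : algebraMap R Ω a + algebraMap R Ω b * i = algebraMap R Ω c + algebraMap R Ω d * i) :
    a = c ∧ b = d := by
  have := hR.eq_zero_of_add_mul_eq_zero (a := a - c) (b := b - d) hi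
    (by rw [map_sub, map_sub]; linear_combination h)
  exact ⟨sub_eq_zero.mp this.1, sub_eq_zero.mp this.2⟩

theorem IsRealRing.exists_conj (hR : IsRealRing R) [IsAlgClosure R Ω] (hi : i ^ 2 = -1) :
    ∃ c : Ω ≃ₐ[R] Ω, c i = -i := by
  have : Normal R Ω := IsAlgClosure.normal R Ω
  have hd : (X ^ 2 + C 1 : R[X]).natDegree = 2 := natDegree_X_pow_add_C
  have hm : (X ^ 2 + C 1 : R[X]).Monic := monic_X_pow_add_C 1 two_ne_zero
  have hirr : Irreducible (X ^ 2 + C 1 : R[X]) := by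
    rw [hm.irreducible_iff_roots_eq_zero_of_degree_le_three (by omega) (by omega),
      Multiset.eq_zero_iff_forall_notMem]
    intro a ha
    have h1 : a ^ 2 + 1 ^ 2 = 0 := by simpa using (mem_roots'.mp ha).2
    exact one_ne_zero (hR.sq_add_sq h1).2
  have hmin : ∀ j : Ω, j ^ 2 = -1 → minpoly R j = X ^ 2 + C 1 := fun j hj =>
    (minpoly.eq_of_irreducible_of_monic hirr (by simp [hj]) hm).symm
  have hconj : IsConjRoot R (-i) i := (hmin _ (by rw [neg_sq, hi])).trans (hmin _ hi).symm
  exact isConjRoot_iff_exists_algEquiv.mp hconj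

theorem IsAlgClosed.exists_sq_eq_neg_one (Ω : Type*) [Field Ω] [IsAlgClosed Ω] :
    ∃ i : Ω, i ^ 2 = -1 :=
  IsAlgClosed.exists_pow_nat_eq _ two_pos

theorem IsRealClosedField.exists_sq_eq_prod (hR : IsRealClosedField R) {n : ℕ} {f : R[X]}
    (hf : f.Monic) (hn : f.natDegree = n) :
    ∃ a b : Fin n → R, f ^ 2 = ∏ j, ((X - C (a j)) ^ 2 + C (b j) ^ 2) := by
  let Ω := AlgebraicClosure R
  obtain ⟨i, hi⟩ := IsAlgClosed.exists_sq_eq_neg_one Ω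
  obtain ⟨c, hc⟩ := hR.1.exists_conj hi
  obtain ⟨z, hz⟩ : ∃ z : Fin n → Ω, f.map (algebraMap R Ω) = ∏ j, (X - C (z j)) := by
    have hs := IsAlgClosed.splits (f.map (algebraMap R Ω))
    set l := (f.map (algebraMap R Ω)).roots.toList with hl
    have hlen : l.length = n := by
      rw [hl, Multiset.length_toList, ← hs.natDegree_eq_card_roots, natDegree_map, hn]
    subst hlen
    refine ⟨fun j => l[j.1], ?_⟩
    rw [Fin.prod_univ_fun_getElem l fun x => X - C x, hl, ← Multiset.prod_coe, ← Multiset.map_coe,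
      Multiset.coe_toList]
    conv_lhs => rw [hs.eq_prod_roots, (hf.map _).leadingCoeff, map_one, one_mul]
  have hz' : f.map (algebraMap R Ω) = ∏ j, (X - C (c (z j))) := by
    have := congrArg (map (c : Ω →+* Ω)) hz
    rw [map_map, Polynomial.map_prod] at this
    have hcomp : (c : Ω →+* Ω).comp (algebraMap R Ω) = algebraMap R Ω :=
      RingHom.ext fun x => c.commutes x
    rw [hcomp] at this
    simpa using this
  choose a b hab using fun j => hR.exists_eq_add_mul hi (z j)
  refine ⟨a, b, map_injective _ (algebraMap R Ω).injective ?_⟩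
  rw [Polynomial.map_pow, sq]
  nth_rw 1 [hz]
  rw [hz', ← Finset.prod_mul_distrib, Polynomial.map_prod]
  refine Finset.prod_congr rfl fun j _ => ?_
  have hiq : (C i : Polynomial Ω) ^ 2 = -1 := by rw [← C_pow, hi, C_neg, C_1]
  rw [hab]
  simp only [map_add, map_mul, AlgEquiv.commutes, hc, map_neg, Polynomial.map_add,
    Polynomial.map_pow, Polynomial.map_sub, map_X, map_C]
  linear_combination -(C (algebraMap R Ω (b j))) ^ 2 * hiq

end RealClosed

theorem IsRealRing.eq_zero_of_sum_sq {A ι : Type*} [CommRing A] [Fintype ι] (h : IsRealRing A)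
    {f : ι → A} (hf : ∑ k, f k ^ 2 = 0) (k : ι) : f k = 0 := by
  have := h _ (fun j => f ((Fintype.equivFin ι).symm j))
    (by rwa [(Fintype.equivFin ι).symm.sum_comp fun k => f k ^ 2]) (Fintype.equivFin ι k)
  simpa using this

theorem IsRealRing.card_le_of_orthogonal {R : Type*} [Field R] (hR : IsRealRing R)
    {ι H : Type*} [Fintype ι] [DecidableEq ι] [Fintype H] (x y : ι → H → R) (s : ι → R)
    (hs : ∀ k, s k ≠ 0)
    (hxy : ∀ k l, ∑ σ, (x k σ * x l σ - y k σ * y l σ) = if k = l then s k ^ 2 else 0)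
    (T : Finset H) (hT : ∀ c : ι → R, (∀ σ ∈ T, ∑ k, c k * x k σ = 0) →
      ∀ σ, ∑ k, c k * x k σ = 0) : Fintype.card ι ≤ T.card := by
  have hli : LinearIndependent R (fun (k : ι) (σ : T) => x k σ) := by
    rw [Fintype.linearIndependent_iff]
    intro c hc k
    have h0 : ∀ σ, ∑ k, c k * x k σ = 0 := hT c fun σ hσ => by
      simpa using congrFun hc ⟨σ, hσ⟩
    have h1 : ∑ k, (c k * s k) ^ 2 = -∑ σ, (∑ k, c k * y k σ) ^ 2 := by
      have h2 : ∑ k, ∑ l, c k * c l * ∑ σ, (x k σ * x l σ - y k σ * y l σ) =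
          ∑ k, (c k * s k) ^ 2 := by
        refine Finset.sum_congr rfl fun k _ => ?_
        simp only [hxy, mul_ite, mul_zero, Finset.sum_ite_eq, Finset.mem_univ, if_true]
        ring
      rw [← h2]
      calc _ = ∑ σ, ((∑ k, c k * x k σ) ^ 2 - (∑ k, c k * y k σ) ^ 2) := by
            simp only [Finset.mul_sum, sq, Finset.sum_mul, ← Finset.sum_sub_distrib]
            rw [Finset.sum_comm' (t' := Finset.univ) (s' := fun _ => Finset.univ) (by simp)]
            simp_rw [Finset.sum_comm (t := (Finset.univ : Finset H))]
            refine Finset.sum_congr rfl fun σ _ => Finset.sum_congr rfl fun k _ =>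
              Finset.sum_congr rfl fun l _ => ?_
            ring
        _ = _ := by simp [h0]
    have h3 := hR.eq_zero_of_sum_sq (ι := ι ⊕ H)
      (f := Sum.elim (fun k => c k * s k) fun σ => ∑ k, c k * y k σ)
      (by rw [Fintype.sum_sum_type]; simp [h1]) (Sum.inl k)
    exact (mul_eq_zero.mp h3).resolve_right (hs k)
  simpa using hli.fintype_card_le_finrank

theorem Function.Involutive.two_mul_card_lt_add_card_eq {H : Type*} [Fintype H] [LinearOrder H]
    {v : H → H} (hv : Function.Involutive v) :
    2 * (Finset.univ.filter fun σ => σ < v σ).card + (Finset.univ.filter fun σ => v σ = σ).card =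
      Fintype.card H := by
  have h1 : (Finset.univ.filter fun σ => σ < v σ).card =
      (Finset.univ.filter fun σ => v σ < σ).card :=
    Finset.card_nbij' v v (by intro σ; simp [hv σ]) (by intro σ; simp [hv σ])
      (fun σ _ => hv σ) (fun σ _ => hv σ)
  have h2 : (Finset.univ : Finset H) = (Finset.univ.filter fun σ => σ < v σ) ∪
      ((Finset.univ.filter fun σ => v σ < σ) ∪ Finset.univ.filter fun σ => v σ = σ) := by
    ext σ
    simpa using (lt_trichotomy σ (v σ)).imp id fun h => h.symm.imp id Eq.symm
  have h3 := congrArg Finset.card h2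
  rw [Finset.card_univ, Finset.card_union_of_disjoint, Finset.card_union_of_disjoint] at h3
  · omega
  · exact Finset.disjoint_filter.mpr fun σ _ h h' => h.ne h'
  · rw [Finset.disjoint_union_right]
    exact ⟨Finset.disjoint_filter.mpr fun σ _ h h' => h.not_gt h',
      Finset.disjoint_filter.mpr fun σ _ h h' => h.ne h'.symm⟩

section Signature

variable {F R L : Type u} [Field F] [Field R] [Algebra F R] [Field L] [Algebra F L]
  [FiniteDimensional F L] [Algebra.IsSeparable F L]

theorem IsRealClosedField.exists_trace_eq_sum (hR : IsRealClosedField R) (Ω : Type*) [Field Ω]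
    [IsAlgClosed Ω] [Algebra R Ω] [IsAlgClosure R Ω] [Algebra F Ω] [IsScalarTower F R Ω] :
    ∃ (v : Fin (Module.finrank F L) → Fin (Module.finrank F L))
      (x y : L → Fin (Module.finrank F L) → R), Function.Involutive v ∧
      (∀ a σ, x a (v σ) = x a σ) ∧ (∀ a σ, y a (v σ) = -y a σ) ∧
      (∀ a b, ∑ σ, (x a σ * x b σ - y a σ * y b σ) =
        algebraMap F R (Algebra.trace F L (a * b))) ∧
      (Nonempty (L →ₐ[F] R) ↔ ∃ σ, v σ = σ) := by
  obtain ⟨i, hi⟩ := IsAlgClosed.exists_sq_eq_neg_one Ω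
  obtain ⟨c, hc⟩ := hR.1.exists_conj hi
  have hc2 : ∀ z, c (c z) = z := fun z => by
    obtain ⟨a, b, rfl⟩ := hR.exists_eq_add_mul hi z
    simp [hc]
  let E : (L →ₐ[F] Ω) ≃ Fin (Module.finrank F L) :=
    Fintype.equivFinOfCardEq (AlgHom.card F L Ω)
  choose X Y hXY using hR.exists_eq_add_mul (Ω := Ω) hi
  have huniq : ∀ a b, X (algebraMap R Ω a + algebraMap R Ω b * i) = a ∧
      Y (algebraMap R Ω a + algebraMap R Ω b * i) = b := fun a b =>
    hR.1.eq_of_add_mul_eq hi (hXY _).symm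
  have hconj : ∀ z, X (c z) = X z ∧ Y (c z) = -Y z := fun z => by
    have h : c z = algebraMap R Ω (X z) + algebraMap R Ω (-Y z) * i := by
      conv_lhs => rw [hXY z]
      simp [hc]
    rw [h]
    exact huniq _ _
  let w : (L →ₐ[F] Ω) → (L →ₐ[F] Ω) := fun σ => (c.restrictScalars F : Ω →ₐ[F] Ω).comp σ
  have hw : ∀ σ a, w σ a = c (σ a) := fun σ a => rfl
  refine ⟨fun k => E (w (E.symm k)), fun a k => X (E.symm k a), fun a k => Y (E.symm k a),
    fun k => ?_, fun a k => ?_, fun a k => ?_, fun a b => ?_, ?_⟩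
  · simp only [Equiv.symm_apply_apply]
    rw [← Equiv.eq_symm_apply]
    exact AlgHom.ext fun a => by rw [hw, hw, hc2]
  · simp only [Equiv.symm_apply_apply]
    exact (hconj _).1
  · simp only [Equiv.symm_apply_apply]
    exact (hconj _).2
  · rw [E.symm.sum_comp fun σ => X (σ a) * X (σ b) - Y (σ a) * Y (σ b)]
    have h1 := trace_eq_sum_embeddings (K := F) (L := L) Ω (x := a * b)
    have h2 : ∑ σ : L →ₐ[F] Ω, σ (a * b) =
        algebraMap R Ω (∑ σ : L →ₐ[F] Ω, (X (σ a) * X (σ b) - Y (σ a) * Y (σ b))) +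
        algebraMap R Ω (∑ σ : L →ₐ[F] Ω, (X (σ a) * Y (σ b) + Y (σ a) * X (σ b))) * i := by
      rw [map_sum, map_sum, Finset.sum_mul, ← Finset.sum_add_distrib]
      refine Finset.sum_congr rfl fun σ _ => ?_
      rw [map_mul]
      conv_lhs => rw [hXY (σ a), hXY (σ b)]
      simp only [map_sub, map_add, map_mul]
      linear_combination (algebraMap R Ω (Y (σ a))) * (algebraMap R Ω (Y (σ b))) * hi
    rw [h2, IsScalarTower.algebraMap_apply F R Ω] at h1
    exact (hR.1.eq_of_add_mul_eq hi (h1.symm.trans (by simp) : _ = _ + algebraMap R Ω 0 * i)).1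
  · constructor
    · rintro ⟨φ⟩
      let σ : L →ₐ[F] Ω := (IsScalarTower.toAlgHom F R Ω).comp φ
      refine ⟨E σ, ?_⟩
      simp only [Equiv.symm_apply_apply]
      congr 1
      exact AlgHom.ext fun a => c.commutes _
    · rintro ⟨k, hk⟩
      have hk' : w (E.symm k) = E.symm k := by rwa [← Equiv.eq_symm_apply] at hk
      have hreal : ∀ a, E.symm k a ∈ (IsScalarTower.toAlgHom F R Ω).range := fun a => by
        have h1 := congrArg Y (DFunLike.congr_fun hk' a)
        rw [hw, (hconj _).2] at h1
        have := hR.1.charZero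
        have h2 : Y (E.symm k a) = 0 := by
          have h3 : (2 : R) * Y (E.symm k a) = 0 := by linear_combination -h1
          exact (mul_eq_zero.mp h3).resolve_left two_ne_zero
        refine ⟨X (E.symm k a), ?_⟩
        conv_rhs => rw [hXY (E.symm k a), h2]
        simp
      exact ⟨((AlgEquiv.ofInjective (IsScalarTower.toAlgHom F R Ω)
        (algebraMap R Ω).injective).symm : _ →ₐ[F] R).comp
          ((E.symm k).codRestrict _ hreal)⟩

variable {ι : Type*} [Fintype ι] [DecidableEq ι] {e : ι → L}

theorem IsRealClosedField.two_mul_card_le_finrank (hR : IsRealClosedField R)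
    (he : ∀ k l, k ≠ l → Algebra.trace F L (e k * e l) = 0) {s : ι → R} (hs : ∀ k, s k ≠ 0)
    (hpos : ∀ k, s k ^ 2 = algebraMap F R (Algebra.trace F L (e k * e k)))
    (hemp : IsEmpty (L →ₐ[F] R)) : 2 * Fintype.card ι ≤ Module.finrank F L := by
  obtain ⟨v, x, y, hv, hx, -, hxy, hfix⟩ := hR.exists_trace_eq_sum (F := F) (L := L)
    (AlgebraicClosure R)
  have hne : ∀ σ, v σ ≠ σ := fun σ h => not_nonempty_iff.mpr hemp (hfix.mpr ⟨σ, h⟩)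
  have hcard := hv.two_mul_card_lt_add_card_eq
  rw [Finset.filter_false_of_mem (p := fun σ => v σ = σ) fun σ _ => hne σ] at hcard
  have := hR.1.card_le_of_orthogonal (fun k => x (e k)) (fun k => y (e k)) s hs (fun k l => by
    rw [hxy]
    split_ifs with h
    · rw [← h, hpos]
    · rw [he k l h, map_zero]) (Finset.univ.filter fun σ => σ < v σ) (fun c hc σ => by
      by_cases h : σ < v σ
      · exact hc σ (by simpa using h)
      · have := hc (v σ) (by simpa [hv σ] using lt_of_le_of_ne (not_lt.mp h) (hne σ))
        simpa only [hx] using this)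
  simp at hcard
  omega

theorem IsRealClosedField.two_mul_card_lt_finrank (hR : IsRealClosedField R)
    (he : ∀ k l, k ≠ l → Algebra.trace F L (e k * e l) = 0) {s : ι → R} (hs : ∀ k, s k ≠ 0)
    (hneg : ∀ k, s k ^ 2 = -algebraMap F R (Algebra.trace F L (e k * e k)))
    (hne : Nonempty (L →ₐ[F] R)) : 2 * Fintype.card ι < Module.finrank F L := by
  obtain ⟨v, x, y, hv, -, hy, hxy, hfix⟩ := hR.exists_trace_eq_sum (F := F) (L := L)
    (AlgebraicClosure R)
  obtain ⟨σ₀, hσ₀⟩ := hfix.mp hne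
  have hcard := hv.two_mul_card_lt_add_card_eq
  have hpos : 0 < (Finset.univ.filter fun σ => v σ = σ).card :=
    Finset.card_pos.mpr ⟨σ₀, by simpa using hσ₀⟩
  have hy' : ∀ (c : ι → R) σ, ∑ k, c k * y (e k) (v σ) = -∑ k, c k * y (e k) σ := fun c σ => by
    simp only [hy, mul_neg, Finset.sum_neg_distrib]
  have := hR.1.charZero
  have := hR.1.card_le_of_orthogonal (fun k => y (e k)) (fun k => x (e k)) s hs (fun k l => by
    have h1 : ∑ σ, (y (e k) σ * y (e l) σ - x (e k) σ * x (e l) σ) =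
        -algebraMap F R (Algebra.trace F L (e k * e l)) := by
      rw [← hxy, ← Finset.sum_neg_distrib]
      exact Finset.sum_congr rfl fun σ _ => by ring
    rw [h1]
    split_ifs with h
    · rw [← h, hneg]
    · rw [he k l h, map_zero, neg_zero]) (Finset.univ.filter fun σ => σ < v σ) (fun c hc σ => by
      rcases lt_trichotomy σ (v σ) with h | h | h
      · exact hc σ (by simpa using h)
      · have := hy' c σ
        rw [← h] at this
        exact self_eq_neg.mp this
      · have := hc (v σ) (by simpa [hv σ] using h)
        rw [hy'] at this
        exact neg_eq_zero.mp this)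
  rw [Fintype.card_fin] at hcard
  omega

theorem IsRealClosedField.nonempty_algHom_of_finiteDimensional {R' : Type u} [Field R']
    [Algebra F R'] (hR : IsRealClosedField R) (hR' : IsRealClosedField R')
    (h : ∀ x : F, (∃ y, y ^ 2 = algebraMap F R x) ↔ ∃ y, y ^ 2 = algebraMap F R' x)
    (hne : Nonempty (L →ₐ[F] R)) : Nonempty (L →ₐ[F] R') := by
  classical
  by_contra hcon
  have hemp := not_nonempty_iff.mp hcon
  have := hR.1.charZero
  have : CharZero F := (algebraMap F R).charZero
  let _ : Invertible (2 : F) := invertibleOfNonzero two_ne_zero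
  obtain ⟨b, hb⟩ := LinearMap.BilinForm.exists_orthogonal_basis
    (LinearMap.BilinForm.isSymm_iff.mp (Algebra.traceForm_isSymm F (S := L)))
  have hb0 := hb.not_isOrtho_basis_self_of_separatingLeft (traceForm_nondegenerate F L).1
  have hb1 : ∀ k l, k ≠ l → Algebra.trace F L (b k * b l) = 0 := fun k l hkl => hb hkl
  have hb2 : ∀ k, algebraMap F R (Algebra.trace F L (b k * b k)) ≠ 0 := fun k => by
    simpa using hb0 k
  let p : Fin (Module.finrank F L) → Prop := fun k =>
    ∃ y, y ^ 2 = algebraMap F R (Algebra.trace F L (b k * b k))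
  have hcard := Fintype.card_subtype_compl p
  have hcard' := Fintype.card_subtype_le p
  rw [Fintype.card_fin] at hcard hcard'
  have h1 : 2 * Fintype.card {k // p k} ≤ Module.finrank F L := by
    choose s hs using fun k : {k // p k} => (h _).mp k.2
    refine hR'.two_mul_card_le_finrank (e := fun k : {k // p k} => b k)
      (fun k l hkl => hb1 _ _ (Subtype.coe_injective.ne hkl)) (s := s) (fun k hk => ?_) hs hemp
    have := hs k
    rw [hk, zero_pow two_ne_zero] at this
    exact hb2 k (by rw [(map_eq_zero _).mp this.symm, map_zero])
  have h2 : 2 * Fintype.card {k // ¬ p k} < Module.finrank F L := by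
    choose s hs using fun k : {k // ¬ p k} => (hR.2.1 _).resolve_left k.2
    refine hR.two_mul_card_lt_finrank (e := fun k : {k // ¬ p k} => b k)
      (fun k l hkl => hb1 _ _ (Subtype.coe_injective.ne hkl)) (s := s) (fun k hk => ?_) hs hne
    have := hs k
    rw [hk, zero_pow two_ne_zero] at this
    exact hb2 k (neg_eq_zero.mp this.symm)
  omega

end Signature

theorem IsRealClosedField.nonempty_algHom {F R R' : Type u} [Field F] [Field R] [Field R']
    [Algebra F R] [Algebra F R'] [Algebra.IsAlgebraic F R] (hR : IsRealClosedField R)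
    (hR' : IsRealClosedField R')
    (h : ∀ x : F, (∃ y, y ^ 2 = algebraMap F R x) ↔ ∃ y, y ^ 2 = algebraMap F R' x) :
    Nonempty (R →ₐ[F] R') := by
  have := hR.1.charZero
  have : CharZero F := (algebraMap F R).charZero
  refine Field.nonempty_algHom_of_exists_root fun x => ?_
  have hx : IsIntegral F x := Algebra.IsIntegral.isIntegral x
  have : FiniteDimensional F (IntermediateField.adjoin F {x}) :=
    IntermediateField.adjoin.finiteDimensional hx
  obtain ⟨φ⟩ := hR.nonempty_algHom_of_finiteDimensional hR' h
    ⟨(IntermediateField.adjoin F {x}).val⟩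
  refine ⟨φ (IntermediateField.AdjoinSimple.gen F x), ?_⟩
  rw [aeval_algHom_apply, IntermediateField.aeval_gen_minpoly, map_zero]

theorem IsPartialOrdering.exists_isRealClosedField {A : Type u} [CommRing A] {P : Set A}
    (hP : IsPartialOrdering P) (hvnr : IsVonNeumannRegular A) (p : Ideal A) [hp : p.IsPrime] :
    ∃ (R : Type u) (_ : Field R) (g : A →+* R), IsRealClosedField R ∧ g.IsIntegral ∧
      RingHom.ker g = p ∧ ∀ a ∈ P, ∃ y, y ^ 2 = g a := by
  have := hvnr.isMaximal p
  let _ : Field (A ⧸ p) := Ideal.Quotient.field p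
  obtain ⟨hadd, hmul, hsq, hneg⟩ := hP
  obtain ⟨R, _, _, halg, hR, hT⟩ :=
    _root_.exists_isRealClosedField (T := (Ideal.Quotient.mk p '' P : Set (A ⧸ p)))
    (by rintro _ ⟨a, ha, rfl⟩ _ ⟨b, hb, rfl⟩; exact ⟨_, hadd a ha b hb, map_add _ _ _⟩)
    (by rintro _ ⟨a, ha, rfl⟩ _ ⟨b, hb, rfl⟩; exact ⟨_, hmul a ha b hb, map_mul _ _ _⟩)
    (by
      intro x
      obtain ⟨a, rfl⟩ := Ideal.Quotient.mk_surjective x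
      exact ⟨_, hsq a, map_pow _ _ _⟩)
    (by
      rintro ⟨z, hz, hz1⟩
      have hzp : 1 + z ∈ p := by
        rw [← Ideal.Quotient.eq_zero_iff_mem, map_add, hz1, map_one, add_neg_cancel]
      obtain ⟨e, c, he, hec, hze⟩ := hvnr.exists_idempotent (1 + z)
      have h1 : 1 - e ∈ P := by
        have : 1 - e = (1 - e) ^ 2 := by linear_combination -he
        rw [this]
        exact hsq _
      have h2 : -(1 - e) ∈ P := by
        have : -(1 - e) = (1 - e) * z := by linear_combination hze
        rw [this]
        exact hmul _ h1 _ hz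
      refine p.ne_top_iff_one.mp hp.ne_top ?_
      rw [← sub_add_cancel 1 e, hneg _ h1 h2, zero_add, hec]
      exact p.mul_mem_right c hzp)
  refine ⟨R, inferInstance, (algebraMap (A ⧸ p) R).comp (Ideal.Quotient.mk p), hR, ?_, ?_, ?_⟩
  · refine RingHom.IsIntegral.trans _ _
      (RingHom.isIntegral_of_surjective _ Ideal.Quotient.mk_surjective) ?_
    exact fun x => Algebra.IsIntegral.isIntegral (R := A ⧸ p) x
  · rw [RingHom.ker_comp_of_injective _ (algebraMap (A ⧸ p) R).injective, Ideal.mk_ker]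
  · exact fun a ha => hT _ ⟨a, ha, rfl⟩

theorem IsRealRing.exists_two_mul_eq_one {A : Type*} [CommRing A] (h : IsRealRing A)
    (hvnr : IsVonNeumannRegular A) : ∃ u : A, 2 * u = 1 := by
  obtain ⟨u, hu⟩ := hvnr 2
  have : (1 - 2 * u) ^ 2 + (1 - 2 * u) ^ 2 = 0 := by linear_combination (1 - 2 * u) * hu
  exact ⟨u, by linear_combination -(h.sq_add_sq this).1⟩

theorem isIntegral_of_dvd_sq {A K W : Type*} [CommRing A] [CommRing K] [CommRing W]
    [Algebra A K] [Algebra A W] (ψ : K →ₐ[A] W) (hψ : Function.Injective ψ) {r : W}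
    (hr : r ^ 2 = -1) {u : A} (hu : 2 * u = 1) {q : A[X]} (hq : q.Monic) {a b : K}
    (hab : (X - C a) ^ 2 + C b ^ 2 ∣ q.map (algebraMap A K) ^ 2) :
    IsIntegral A a ∧ IsIntegral A b := by
  have hroot : ∀ s : W, s ^ 2 = -1 → IsIntegral A (ψ a + ψ b * s) := by
    intro s hs
    refine ⟨q ^ 2, hq.pow 2, ?_⟩
    obtain ⟨g, hg⟩ := hab
    have h1 := congrArg (eval₂ (ψ : K →+* W) (ψ a + ψ b * s)) hg
    rw [← Polynomial.map_pow, eval₂_map, AlgHom.comp_algebraMap, eval₂_mul] at h1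
    rw [h1]
    simp only [eval₂_add, eval₂_pow, eval₂_sub, eval₂_X, eval₂_C, RingHom.coe_coe]
    rw [show (ψ a + ψ b * s - ψ a) ^ 2 + ψ b ^ 2 = 0 by linear_combination (ψ b) ^ 2 * hs, zero_mul]
  have h1 := hroot r hr
  have h2 := hroot (-r) (by rw [neg_sq, hr])
  have hu' : 2 * algebraMap A W u = 1 := by
    rw [← map_ofNat (algebraMap A W) 2, ← map_mul, hu, map_one]
  have ha : IsIntegral A (ψ a) := by
    have := (isIntegral_algebraMap (A := W) (x := u)).mul (h1.add h2)
    rwa [show algebraMap A W u * (ψ a + ψ b * r + (ψ a + ψ b * -r)) = ψ a by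
      linear_combination (ψ a) * hu'] at this
  have hb : IsIntegral A (ψ b) := by
    refine IsIntegral.of_pow two_pos ?_
    have := (h1.mul h2).sub (ha.pow 2)
    rwa [show (ψ a + ψ b * r) * (ψ a + ψ b * -r) - ψ a ^ 2 = ψ b ^ 2 by
      linear_combination -(ψ b) ^ 2 * hr] at this
  exact ⟨(isIntegral_algHom_iff ψ hψ).mp ha, (isIntegral_algHom_iff ψ hψ).mp hb⟩

section Pi

variable {A : Type u} [CommRing A] {ι : Type u} {R : ι → Type u} [∀ i, Field (R i)]
  [∀ i, Algebra A (R i)] {D : Type u} [CommRing D]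

theorem exists_eq_of_idempotent (π : integralClosure A (∀ i, R i) →+* D)
    (hess : IsEssentialExtension (π.comp (algebraMap A _))) {e : D} (he : e * e = e) :
    ∃ γ, π γ = e := by
  classical
  set h := π.comp (algebraMap A (integralClosure A (∀ i, R i))) with hh
  let γ₀ : ∀ i, R i := fun i =>
    if ∃ t : A, e * h t = h t ∧ algebraMap A (R i) t ≠ 0 then 1 else 0
  have hγ₀ : γ₀ ^ 2 = γ₀ := by
    funext i
    simp only [Pi.pow_apply, γ₀]
    split_ifs <;> simp
  have hint : IsIntegral A γ₀ := ⟨X ^ 2 - X, monic_X_pow_sub (degree_X_le.trans_lt (by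
      exact_mod_cast one_lt_two)),
    by simp [hγ₀]⟩
  let γ : integralClosure A (∀ i, R i) := ⟨γ₀, hint⟩
  have hγ : π γ * π γ = π γ := by
    rw [← map_mul]
    congr 1
    exact Subtype.ext (by rw [← sq]; exact hγ₀)
  have hT : ∀ t, e * h t = h t → π γ * h t = h t := by
    intro t ht
    rw [hh, RingHom.comp_apply, ← map_mul]
    congr 1
    refine Subtype.ext (funext fun i => ?_)
    change γ₀ i * algebraMap A (R i) t = algebraMap A (R i) t
    by_cases h0 : algebraMap A (R i) t = 0
    · rw [h0, mul_zero]
    · simp only [γ₀]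
      rw [if_pos ⟨t, ht, h0⟩, one_mul]
  have hS : ∀ s, e * h s = 0 → π γ * h s = 0 := by
    intro s hs
    rw [hh, RingHom.comp_apply, ← map_mul, ← map_zero π]
    congr 1
    refine Subtype.ext (funext fun i => ?_)
    change γ₀ i * algebraMap A (R i) s = 0
    simp only [γ₀]
    split_ifs with hi
    · obtain ⟨t, ht, ht0⟩ := hi
      have hts : t * s = 0 := hess.1 (by
        rw [map_mul, map_zero, ← ht]
        linear_combination h t * hs)
      have := congrArg (algebraMap A (R i)) hts
      rw [map_mul, map_zero] at this
      rw [(mul_eq_zero.mp this).resolve_left ht0, mul_zero]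
    · rw [zero_mul]
  have h1 : π γ * (1 - e) = 0 := by
    by_contra hne
    obtain ⟨a, ha, ha0⟩ := hess.2 (Ideal.span {π γ * (1 - e)})
      (by rwa [Ne, Ideal.span_singleton_eq_bot])
    obtain ⟨d, hd⟩ := Ideal.mem_span_singleton'.mp ha
    have h2 := hS a (by rw [← hd]; linear_combination -d * π γ * he)
    exact ha0 (by rw [← h2, ← hd]; linear_combination -d * (1 - e) * hγ)
  have h2 : (1 - π γ) * e = 0 := by
    by_contra hne
    obtain ⟨a, ha, ha0⟩ := hess.2 (Ideal.span {(1 - π γ) * e})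
      (by rwa [Ne, Ideal.span_singleton_eq_bot])
    obtain ⟨d, hd⟩ := Ideal.mem_span_singleton'.mp ha
    have h2 := hT a (by rw [← hd]; linear_combination d * (1 - π γ) * he)
    exact ha0 (by rw [← h2, ← hd]; linear_combination -d * e * hγ)
  exact ⟨γ, by linear_combination h1 - h2⟩

theorem exists_sq_map_eq_prod (hR : ∀ i, IsRealClosedField (R i)) {u : A} (hu : 2 * u = 1)
    {q : A[X]} (hq : q.Monic) :
    ∃ a b : Fin q.natDegree → integralClosure A (∀ i, R i),
      q.map (algebraMap A (integralClosure A (∀ i, R i))) ^ 2 =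
        ∏ j, ((X - C (a j)) ^ 2 + C (b j) ^ 2) := by
  choose a b hab using fun i => (hR i).exists_sq_eq_prod (hq.map (algebraMap A (R i)))
    (hq.natDegree_map (algebraMap A (R i)))
  have hK : q.map (algebraMap A (∀ i, R i)) ^ 2 =
      ∏ j, ((X - C fun i => a i j) ^ 2 + C (fun i => b i j) ^ 2) := by
    ext k i
    have h1 := congrArg (fun f => coeff f k) (hab i)
    have h2 : ∀ f : (∀ i, R i)[X], f.coeff k i = (f.map (Pi.evalRingHom R i)).coeff k := fun f => by
      rw [coeff_map, Pi.evalRingHom_apply]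
    rw [h2, h2, Polynomial.map_pow, map_map, Polynomial.map_prod,
      show (Pi.evalRingHom R i).comp (algebraMap A _) = algebraMap A (R i) from rfl]
    simpa using h1
  choose r hr using fun i => IsAlgClosed.exists_sq_eq_neg_one (AlgebraicClosure (R i))
  let ψ : (∀ i, R i) →ₐ[A] ∀ i, AlgebraicClosure (R i) := AlgHom.pi fun i =>
    (IsScalarTower.toAlgHom A (R i) (AlgebraicClosure (R i))).comp (Pi.evalAlgHom A R i)
  have hψ : Function.Injective ψ := fun x y hxy => funext fun i =>
    (algebraMap (R i) (AlgebraicClosure (R i))).injective (congrFun hxy i)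
  have hint := fun j => isIntegral_of_dvd_sq ψ hψ (r := r) (funext hr) hu hq
    (hK ▸ Finset.dvd_prod_of_mem _ (Finset.mem_univ j))
  refine ⟨fun j => ⟨_, (hint j).1⟩, fun j => ⟨_, (hint j).2⟩,
    map_injective (integralClosure A (∀ i, R i)).val.toRingHom Subtype.val_injective ?_⟩
  rw [Polynomial.map_pow, map_map, Polynomial.map_prod]
  simpa using hK

theorem surjective_of_isRealRing (hR : ∀ i, IsRealClosedField (R i)) {u : A} (hu : 2 * u = 1)
    (hD : IsRealRing D) (hvnr : IsVonNeumannRegular D)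
    (π : integralClosure A (∀ i, R i) →+* D)
    (hess : IsEssentialExtension (π.comp (algebraMap A _)))
    (hint : (π.comp (algebraMap A _)).IsIntegral) : Function.Surjective π := by
  intro d
  let I : Ideal (integralClosure A (∀ i, R i)) :=
    { carrier := {c | π c * d ∈ π.range}
      zero_mem' := ⟨0, by rw [map_zero, zero_mul]⟩
      add_mem' := fun {x y} hx hy => by
        simp only [Set.mem_ofPred_eq, map_add, add_mul] at *
        exact add_mem hx hy
      smul_mem' := fun c x hx => by
        simp only [Set.mem_ofPred_eq, smul_eq_mul, map_mul, mul_assoc] at *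
        exact mul_mem ⟨c, rfl⟩ hx }
  suffices I = ⊤ by
    have h1 : (1 : integralClosure A (∀ i, R i)) ∈ I := this ▸ Submodule.mem_top
    simpa [I] using h1
  by_contra hI
  obtain ⟨n, hn, hIn⟩ := I.exists_le_maximal hI
  have hπ : π.IsIntegral := RingHom.IsIntegral.tower_top _ _ hint
  let _ := π.toAlgebra
  have : Algebra.IsIntegral (integralClosure A (∀ i, R i)) D := ⟨hπ⟩
  obtain ⟨m, -, hm, hmn⟩ := Ideal.exists_ideal_over_prime_of_isIntegral n (⊥ : Ideal D) (by
    intro c hc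
    have hc' : π c = 0 := hc
    exact hIn ⟨0, by rw [map_zero, hc', zero_mul]⟩)
  obtain ⟨q, hq, hqd⟩ := hint d
  obtain ⟨a, b, hab⟩ := exists_sq_map_eq_prod hR hu hq
  have h1 : ∏ j, ((d - π (a j)) ^ 2 + π (b j) ^ 2) = 0 := by
    have h2 := congrArg (eval₂ π d) hab
    rw [eval₂_pow, eval₂_map, hqd, zero_pow two_ne_zero, eval₂_finsetProd] at h2
    simpa [eval₂_add, eval₂_pow, eval₂_sub] using h2.symm
  obtain ⟨j, -, hj⟩ := hm.prod_mem_iff.mp (h1 ▸ m.zero_mem)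
  have h3 : d - π (a j) ∈ m := by
    rw [← Ideal.Quotient.eq_zero_iff_mem]
    refine ((hD.quotient hvnr m).sq_add_sq (b := Ideal.Quotient.mk m (π (b j))) ?_).1
    rw [← map_pow, ← map_pow, ← map_add]
    exact Ideal.Quotient.eq_zero_iff_mem.mpr hj
  obtain ⟨e, c, he, hec, hde⟩ := hvnr.exists_idempotent (d - π (a j))
  obtain ⟨γ, hγ⟩ := exists_eq_of_idempotent π hess (e := 1 - e) (by linear_combination he)
  have hγI : γ ∈ I := ⟨γ * a j, by rw [map_mul, hγ]; linear_combination hde⟩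
  have hγm : π γ ∈ m := by
    have : γ ∈ m.comap (algebraMap _ D) := hmn ▸ hIn hγI
    exact this
  refine m.ne_top_iff_one.mp hm.ne_top ?_
  rw [← sub_add_cancel 1 e, ← hγ]
  exact m.add_mem hγm (hec ▸ m.mul_mem_right c h3)

end Pi

theorem isPartialOrdering_sq {B : Type*} [CommRing B] (hB : IsRealRing B)
    (hadd : ∀ x y : B, ∃ z, z ^ 2 = x ^ 2 + y ^ 2) :
    IsPartialOrdering {b : B | ∃ y, y ^ 2 = b} := by
  refine ⟨?_, ?_, fun a => ⟨a, rfl⟩, ?_⟩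
  · rintro _ ⟨x, rfl⟩ _ ⟨y, rfl⟩
    exact hadd x y
  · rintro _ ⟨x, rfl⟩ _ ⟨y, rfl⟩
    exact ⟨x * y, mul_pow x y 2⟩
  · rintro _ ⟨x, rfl⟩ ⟨y, hy⟩
    rw [(hB.sq_add_sq (a := x) (b := y) (by rw [hy, add_neg_cancel])).1, zero_pow two_ne_zero]

theorem IsPartialOrdering.exists_isRealClosureStarOf {A : Type u} [CommRing A] {P : Set A}
    (hP : IsPartialOrdering P) (hvnr : IsVonNeumannRegular A) :
    ∃ (B : Type u) (_ : CommRing B) (f : A →+* B),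
      IsRealClosureStarOf A P B {b | ∃ y, y ^ 2 = b} f := by
  have := hvnr.isReduced
  have hreal : IsRealRing A := hP.isRealRing
  choose R hF g hR hgint hker hsq using fun p : PrimeSpectrum A =>
    hP.exists_isRealClosedField hvnr p.asIdeal
  let _ : ∀ p, Algebra A (R p) := fun p => (g p).toAlgebra
  let C := integralClosure A (∀ p, R p)
  have hKreal : IsRealRing (∀ p, R p) := IsRealRing.pi fun p => (hR p).1
  have hCreal : IsRealRing C := hKreal.of_injective C.val.toRingHom Subtype.val_injective
  have hCint : (algebraMap A C).IsIntegral := fun x => Algebra.IsIntegral.isIntegral (R := A) x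
  have := hCreal.isReduced
  have hCvnr : IsVonNeumannRegular C := hvnr.of_isIntegral _ hCint
  have hinj : Function.Injective (algebraMap A C) := by
    rw [injective_iff_map_eq_zero]
    intro a ha
    refine nilpotent_iff_mem_prime.mpr (fun p hp => ?_) |>.eq_zero
    have h1 : g ⟨p, hp⟩ a = 0 := congrFun (congrArg Subtype.val ha) ⟨p, hp⟩
    rw [← RingHom.mem_ker, hker] at h1
    exact h1
  have hCsq : ∀ c : C, (∀ p, ∃ y, y ^ 2 = c.1 p) → ∃ z : C, z ^ 2 = c := by
    intro c hc
    choose y hy using hc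
    have hy' : y ^ 2 = c.1 := funext hy
    exact ⟨⟨y, IsIntegral.of_pow two_pos (hy' ▸ c.2)⟩, Subtype.ext hy'⟩
  obtain ⟨J, hJ⟩ := exists_ideal_isEssentialExtension _ hinj
  have hBint : ((Ideal.Quotient.mk J).comp (algebraMap A C)).IsIntegral :=
    hCint.trans _ _ (RingHom.isIntegral_of_surjective _ Ideal.Quotient.mk_surjective)
  have hBreal : IsRealRing (C ⧸ J) := hCreal.quotient hCvnr J
  have hadd : ∀ x y : C ⧸ J, ∃ z, z ^ 2 = x ^ 2 + y ^ 2 := by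
    intro x y
    obtain ⟨x, rfl⟩ := Ideal.Quotient.mk_surjective x
    obtain ⟨y, rfl⟩ := Ideal.Quotient.mk_surjective y
    obtain ⟨z, hz⟩ := hCsq (x ^ 2 + y ^ 2) fun p => (hR p).exists_sq_eq_sq_add_sq _ _
    exact ⟨Ideal.Quotient.mk J z, by rw [← map_pow, hz, map_add, map_pow, map_pow]⟩
  obtain ⟨u, hu⟩ := hreal.exists_two_mul_eq_one hvnr
  refine ⟨C ⧸ J, inferInstance, _, isPartialOrdering_sq hBreal hadd, ⟨hBreal, ?_⟩, hJ, hBint, ?_⟩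
  · intro D _ k hD hess hint
    have hall : ((k.comp (Ideal.Quotient.mk J)).comp (algebraMap A C)).IsIntegral :=
      hBint.trans _ _ hint
    have := hD.isReduced
    exact Function.Surjective.of_comp (surjective_of_isRealRing hR hu hD
      (hvnr.of_isIntegral _ hall) (k.comp (Ideal.Quotient.mk J)) (hJ.comp hess) hall)
  · intro a ha
    obtain ⟨z, hz⟩ := hCsq (algebraMap A C a) fun p => hsq p a ha
    exact ⟨Ideal.Quotient.mk J z, by rw [← map_pow, hz]; rfl⟩

theorem IsRealClosureStarOf.mem_iff {A : Type u} [CommRing A] {P : Set A} {B : Type u}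
    [CommRing B] {Q : Set B} {f : A →+* B} (hvnr : IsVonNeumannRegular A)
    (h : IsRealClosureStarOf A P B Q f) (b : B) : b ∈ Q ↔ ∃ y, y ^ 2 = b := by
  refine ⟨fun hb => ?_, fun ⟨y, hy⟩ => hy ▸ h.pos_partial.2.2.1 y⟩
  have := h.rcs.1.isReduced
  obtain ⟨C, _, k, hk⟩ :=
    h.pos_partial.exists_isRealClosureStarOf (hvnr.of_isIntegral f h.integral)
  obtain ⟨y, hy⟩ := hk.mono b hb
  obtain ⟨x, rfl⟩ := h.rcs.2 C k hk.rcs.1 hk.essential hk.integral y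
  exact ⟨x, hk.essential.1 (by rw [map_pow, hy])⟩

/-- The prime cone of a ring pulled back from the ordering of a real closed field. -/
def IsRealClosedField.primeCone {A R : Type u} [CommRing A] [Field R] (hR : IsRealClosedField R)
    (g : A →+* R) : PrimeCone A where
  carrier := {a | ∃ y, y ^ 2 = g a}
  add_mem := by
    rintro a ⟨x, hx⟩ b ⟨y, hy⟩
    obtain ⟨z, hz⟩ := hR.exists_sq_eq_sq_add_sq x y
    exact ⟨z, by rw [hz, hx, hy, map_add]⟩
  mul_mem := by
    rintro a ⟨x, hx⟩ b ⟨y, hy⟩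
    exact ⟨x * y, by rw [mul_pow, hx, hy, map_mul]⟩
  sq_mem a := ⟨g a, (map_pow g a 2).symm⟩
  mem_or_neg_mem a := by
    simpa only [Set.mem_ofPred_eq, map_neg] using hR.2.1 (g a)
  support := RingHom.ker g
  mem_support a := by
    rw [RingHom.mem_ker]
    constructor
    · intro h
      exact ⟨⟨0, by rw [h, zero_pow two_ne_zero]⟩,
        ⟨0, by rw [map_neg, h, neg_zero, zero_pow two_ne_zero]⟩⟩
    · rintro ⟨⟨x, hx⟩, y, hy⟩
      have := (hR.1.sq_add_sq (a := x) (b := y)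
        (by rw [hx, hy, map_neg, add_neg_cancel])).1
      rw [← hx, this, zero_pow two_ne_zero]
  support_isPrime := RingHom.ker_isPrime g

theorem exists_ringHom_of_existsUnique {A : Type u} [CommRing A] {P : Set A} {p : Ideal A}
    [p.IsMaximal] (huniq : ∃! α : RealSpectrum A P, α.1.support = p) {R₁ R₂ : Type u} [Field R₁]
    [Field R₂] (hR₁ : IsRealClosedField R₁) (hR₂ : IsRealClosedField R₂) {g₁ : A →+* R₁}
    {g₂ : A →+* R₂} (hint : g₁.IsIntegral) (hk₁ : RingHom.ker g₁ = p) (hk₂ : RingHom.ker g₂ = p)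
    (hP₁ : ∀ a ∈ P, ∃ y, y ^ 2 = g₁ a) (hP₂ : ∀ a ∈ P, ∃ y, y ^ 2 = g₂ a) :
    ∃ φ : R₁ →+* R₂, φ.comp g₁ = g₂ := by
  let _ : Field (A ⧸ p) := Ideal.Quotient.field p
  let _ : Algebra (A ⧸ p) R₁ := (Ideal.Quotient.lift p g₁ fun a ha => by
    rwa [← hk₁, RingHom.mem_ker] at ha).toAlgebra
  let _ : Algebra (A ⧸ p) R₂ := (Ideal.Quotient.lift p g₂ fun a ha => by
    rwa [← hk₂, RingHom.mem_ker] at ha).toAlgebra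
  have h₁ : (algebraMap (A ⧸ p) R₁).comp (Ideal.Quotient.mk p) = g₁ := RingHom.ext fun _ => rfl
  have h₂ : (algebraMap (A ⧸ p) R₂).comp (Ideal.Quotient.mk p) = g₂ := RingHom.ext fun _ => rfl
  have hint' : Algebra.IsIntegral (A ⧸ p) R₁ :=
    ⟨RingHom.IsIntegral.tower_top (Ideal.Quotient.mk p) _ (h₁ ▸ hint)⟩
  have hcone : (⟨hR₁.primeCone g₁, hP₁⟩ : RealSpectrum A P) = ⟨hR₂.primeCone g₂, hP₂⟩ :=
    huniq.unique hk₁ hk₂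
  have hsq : ∀ a : A, (∃ y, y ^ 2 = g₁ a) ↔ ∃ y, y ^ 2 = g₂ a := fun a =>
    Set.ext_iff.mp (congrArg (fun α : RealSpectrum A P => α.1.carrier) hcone) a
  obtain ⟨φ⟩ := hR₁.nonempty_algHom (F := A ⧸ p) hR₂ fun x => by
    obtain ⟨a, rfl⟩ := Ideal.Quotient.mk_surjective x
    exact hsq a
  exact ⟨φ, by rw [← h₁, ← h₂, ← RingHom.comp_assoc, φ.comp_algebraMap]⟩

theorem IsRealClosureStarOf.exists_ringHom {A : Type u} [CommRing A] {P : Set A} {B : Type u}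
    [CommRing B] {Q : Set B} {f : A →+* B} (hvnr : IsVonNeumannRegular A)
    (h : IsRealClosureStarOf A P B Q f) (p : Ideal A) [p.IsPrime] :
    ∃ (R : Type u) (_ : Field R) (k : B →+* R), IsRealClosedField R ∧ (k.comp f).IsIntegral ∧
      RingHom.ker (k.comp f) = p ∧ ∀ a ∈ P, ∃ y, y ^ 2 = k (f a) := by
  have := h.rcs.1.isReduced
  let _ := f.toAlgebra
  have : Algebra.IsIntegral A B := ⟨h.integral⟩
  obtain ⟨q, -, hq, hqp⟩ := Ideal.exists_ideal_over_prime_of_isIntegral p (⊥ : Ideal B) (by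
    intro a ha
    have ha' : f a = 0 := ha
    rw [h.essential.1 (ha'.trans (map_zero f).symm)]
    exact p.zero_mem)
  obtain ⟨R, _, k, hR, hk, hker, hsq⟩ := h.pos_partial.exists_isRealClosedField
    (hvnr.of_isIntegral f h.integral) q
  refine ⟨R, inferInstance, k, hR, h.integral.trans _ _ hk, ?_, fun a ha => hsq _ (h.mono a ha)⟩
  rw [← RingHom.comap_ker, hker]
  exact hqp

theorem IsRealClosureStarOf.exists_ringEquiv {A : Type u} [CommRing A] {P : Set A}
    (hreal : IsRealRing A) (hvnr : IsVonNeumannRegular A)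
    (hdense : Dense {p : PrimeSpectrum A |
      ∃! α : RealSpectrum A P, α.1.support = p.asIdeal}) {B₁ B₂ : Type u} [CommRing B₁]
    [CommRing B₂] {Q₁ : Set B₁} {Q₂ : Set B₂} {f₁ : A →+* B₁} {f₂ : A →+* B₂}
    (h₁ : IsRealClosureStarOf A P B₁ Q₁ f₁) (h₂ : IsRealClosureStarOf A P B₂ Q₂ f₂) :
    ∃ e : B₁ ≃+* B₂, ∀ a, e (f₁ a) = f₂ a := by
  set S := {p : PrimeSpectrum A | ∃! α : RealSpectrum A P, α.1.support = p.asIdeal}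
  have key : ∀ p : S, ∃ (R : Type u) (_ : Field R) (k₁ : B₁ →+* R) (k₂ : B₂ →+* R),
      IsRealClosedField R ∧ k₁.comp f₁ = k₂.comp f₂ ∧ RingHom.ker (k₂.comp f₂) = p.1.asIdeal := by
    intro p
    have := hvnr.isMaximal p.1.asIdeal
    obtain ⟨R₁, _, k₁, hR₁, hk₁, hker₁, hsq₁⟩ := h₁.exists_ringHom hvnr p.1.asIdeal
    obtain ⟨R₂, _, k₂, hR₂, -, hker₂, hsq₂⟩ := h₂.exists_ringHom hvnr p.1.asIdeal
    obtain ⟨φ, hφ⟩ := exists_ringHom_of_existsUnique p.2 hR₁ hR₂ hk₁ hker₁ hker₂ hsq₁ hsq₂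
    exact ⟨R₂, inferInstance, φ.comp k₁, k₂, hR₂, hφ, hker₂⟩
  choose R hF k₁ k₂ hR hcomp hker using key
  let _ : ∀ p, Algebra A (R p) := fun p => ((k₂ p).comp (f₂)).toAlgebra
  let D := integralClosure A (∀ p, R p)
  have hDreal : IsRealRing D := (IsRealRing.pi fun p => (hR p).1).of_injective
    D.val.toRingHom Subtype.val_injective
  have hDint : (algebraMap A D).IsIntegral := fun x => Algebra.IsIntegral.isIntegral (R := A) x
  have := hDreal.isReduced
  have := hreal.isReduced
  have hDvnr : IsVonNeumannRegular D := hvnr.of_isIntegral _ hDint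
  have hinj : Function.Injective (algebraMap A D) := by
    rw [injective_iff_map_eq_zero]
    intro a ha
    by_contra ha0
    have hne : (PrimeSpectrum.basicOpen a : Set (PrimeSpectrum A)).Nonempty := by
      rw [Set.nonempty_iff_ne_empty, Ne, ← TopologicalSpace.Opens.coe_bot, SetLike.coe_set_eq,
        PrimeSpectrum.basicOpen_eq_bot_iff]
      exact fun hnil => ha0 hnil.eq_zero
    obtain ⟨p, hpa, hp⟩ := hdense.inter_open_nonempty _ (PrimeSpectrum.isOpen_basicOpen) hne
    have h3 : (k₂ ⟨p, hp⟩).comp f₂ a = 0 := congrFun (congrArg Subtype.val ha) ⟨p, hp⟩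
    rw [← RingHom.mem_ker, hker] at h3
    exact hpa h3
  obtain ⟨J, hJ⟩ := exists_ideal_isEssentialExtension _ hinj
  have hint : ((Ideal.Quotient.mk J).comp (algebraMap A D)).IsIntegral :=
    hDint.trans _ _ (RingHom.isIntegral_of_surjective _ Ideal.Quotient.mk_surjective)
  have main : ∀ {B : Type u} [CommRing B] {Q : Set B} {f : A →+* B}
      (_ : IsRealClosureStarOf A P B Q f) (k : ∀ p, B →+* R p),
      (∀ p, (k p).comp f = (k₂ p).comp f₂) →
      ∃ e : B ≃+* D ⧸ J, ∀ a, e (f a) = Ideal.Quotient.mk J (algebraMap A D a) := by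
    intro B _ Q f h k hk
    have hmem : ∀ b, RingHom.pi k b ∈ D.toSubring := by
      intro b
      obtain ⟨q, hq, hqb⟩ := h.integral b
      refine ⟨q, hq, ?_⟩
      have h4 := congrArg (RingHom.pi k) hqb
      rw [hom_eval₂, map_zero] at h4
      rw [← h4]
      congr 1
      exact RingHom.ext fun a => funext fun p => (DFunLike.congr_fun (hk p) a).symm
    let m : B →+* D := (RingHom.pi k).codRestrict D.toSubring hmem
    have hm : m.comp f = algebraMap A D :=
      RingHom.ext fun a => Subtype.ext (funext fun p => DFunLike.congr_fun (hk p) a)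
    have hm' : ((Ideal.Quotient.mk J).comp m).comp f =
        (Ideal.Quotient.mk J).comp (algebraMap A D) := by
      rw [RingHom.comp_assoc, hm]
    have hess : IsEssentialExtension ((Ideal.Quotient.mk J).comp m) :=
      h.essential.of_comp (hm' ▸ hJ)
    have hsurj := h.rcs.2 (D ⧸ J) _ (hDreal.quotient hDvnr J) hess
      (RingHom.IsIntegral.tower_top f _ (hm' ▸ hint))
    exact ⟨RingEquiv.ofBijective _ ⟨hess.1, hsurj⟩, fun a => DFunLike.congr_fun hm' a⟩
  obtain ⟨e₁, he₁⟩ := main h₁ k₁ hcomp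
  obtain ⟨e₂, he₂⟩ := main h₂ k₂ fun _ => rfl
  refine ⟨e₁.trans e₂.symm, fun a => ?_⟩
  rw [RingEquiv.trans_apply, he₁, ← he₂, RingEquiv.symm_apply_apply]

/-- Let `(A, P)` be a real von Neumann regular poring such that the set
of primes `p ∈ Spec A` carrying exactly one prime cone `α ∈ Sper A` with `supp α = p`
is dense in `Spec A`.  Then `A` has a unique real closure *. -/
theorem hasUniqueRealClosureStar_of_dense
    (A : Type u) [CommRing A] (P : Set A) (hP : IsPartialOrdering P)
    (hreal : IsRealRing A) (hvnr : IsVonNeumannRegular A)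
    (hdense : Dense {p : PrimeSpectrum A |
      ∃! α : RealSpectrum A P, α.1.support = p.asIdeal}) :
    HasUniqueRealClosureStar A P := by
  constructor
  · obtain ⟨B, _, f, h⟩ := hP.exists_isRealClosureStarOf hvnr
    exact ⟨⟨B, _, f, h⟩⟩
  · intro B C
    obtain ⟨e, he⟩ := B.is.exists_ringEquiv hreal hvnr hdense C.is
    refine ⟨e, he, fun b => ?_⟩
    rw [B.is.mem_iff hvnr, C.is.mem_iff hvnr]
    constructor
    · rintro ⟨y, rfl⟩
      exact ⟨e y, (map_pow e y 2).symm⟩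
    · rintro ⟨y, hy⟩
      exact ⟨e.symm y, by rw [← map_pow, hy, RingEquiv.symm_apply_apply]⟩
end

section
/- Let A be a real Baer von Neumann regular ring, let p be an isolated point of Spec A, let e ∈ A be an idempotent with V(e) = {p} (i.e., e ∈ q for a prime q exactly when q = p), and regard A as a subring of B := ∏_{q ∈ Spec A} A/q via the canonical embedding. Let I be an ideal of B with I ⊆ eB and I ∩ A = {0} such that (I + xB) ∩ A ≠ {0} for every x ∈ eB ∖ I (i.e., I is maximal among ideals of B contained in eB meeting A trivially). Then (I + xB) ∩ A ≠ {0} for every x ∈ B ∖ I; equivalently, the induced map A → B/I is an essential ring extension. -/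
universe u

/-- The canonical embedding of a (reduced) ring into the product of its residue rings. -/
def residueEmbedding (A : Type u) [CommRing A] :
    A →+* ∀ q : PrimeSpectrum A, A ⧸ q.asIdeal :=
  Pi.ringHom fun q => Ideal.Quotient.mk q.asIdeal

/-- An idempotent outside a prime ideal is congruent to `1` modulo it. -/
lemma Ideal.IsPrime.mk_eq_one_of_mul_self_eq {A : Type*} [CommRing A] {q : Ideal A}
    (hq : q.IsPrime) {e : A} (hidem : e * e = e) (he : e ∉ q) :
    Ideal.Quotient.mk q e = 1 := by
  have hmem : e * (e - 1) ∈ q := by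
    rw [mul_sub, hidem, mul_one, sub_self]
    exact q.zero_mem
  rw [← map_one (Ideal.Quotient.mk q), Ideal.Quotient.eq]
  exact (hq.mem_or_mem hmem).resolve_left he

/-- In a von Neumann regular ring, an element outside a prime ideal is invertible modulo it. -/
lemma IsVonNeumannRegular.exists_mk_mul_eq_one {A : Type*} [CommRing A]
    (hvnr : IsVonNeumannRegular A) {q : Ideal A} (hq : q.IsPrime) {x : A ⧸ q} (hx : x ≠ 0) :
    ∃ y : A ⧸ q, y * x = 1 := by
  obtain ⟨a, rfl⟩ := Ideal.Quotient.mk_surjective x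
  obtain ⟨b, hb⟩ := hvnr a
  have hmem : a * (b * a - 1) ∈ q := by
    rw [show a * (b * a - 1) = 0 by linear_combination -hb]
    exact q.zero_mem
  have ha : a ∉ q := fun h => hx (Ideal.Quotient.eq_zero_iff_mem.mpr h)
  refine ⟨Ideal.Quotient.mk q b, ?_⟩
  rw [← map_mul, ← map_one (Ideal.Quotient.mk q), Ideal.Quotient.eq]
  exact (hq.mem_or_mem hmem).resolve_left ha

/-- If `e` is an idempotent with `V(e) = {p}`, every tuple vanishing at `p` is a multiple
of `e`. -/
lemma mem_span_residueEmbedding_of_apply_eq_zero {A : Type u} [CommRing A]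
    {p : PrimeSpectrum A} {e : A} (hidem : e * e = e)
    (hVe : ∀ q : PrimeSpectrum A, e ∈ q.asIdeal ↔ q = p)
    {x : ∀ q : PrimeSpectrum A, A ⧸ q.asIdeal} (hx : x p = 0) :
    x ∈ Ideal.span {residueEmbedding A e} := by
  refine Ideal.mem_span_singleton'.mpr ⟨x, funext fun q => ?_⟩
  change x q * Ideal.Quotient.mk q.asIdeal e = x q
  by_cases hq : q = p
  · subst hq
    rw [hx, zero_mul]
  · rw [q.isPrime.mk_eq_one_of_mul_self_eq hidem (mt (hVe q).mp hq), mul_one]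

/-- If `e` is an idempotent with `V(e) = {p}`, every tuple that does not vanish at `p`
divides `1 - e`. -/
lemma residueEmbedding_one_sub_mem_span {A : Type u} [CommRing A]
    (hvnr : IsVonNeumannRegular A) {p : PrimeSpectrum A} {e : A} (hidem : e * e = e)
    (hVe : ∀ q : PrimeSpectrum A, e ∈ q.asIdeal ↔ q = p)
    {x : ∀ q : PrimeSpectrum A, A ⧸ q.asIdeal} (hx : x p ≠ 0) :
    residueEmbedding A (1 - e) ∈ Ideal.span {x} := by
  classical
  obtain ⟨y, hy⟩ := hvnr.exists_mk_mul_eq_one p.isPrime hx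
  refine Ideal.mem_span_singleton'.mpr ⟨Pi.single p y, funext fun q => ?_⟩
  change Pi.single (M := fun q : PrimeSpectrum A => A ⧸ q.asIdeal) p y q * x q =
    Ideal.Quotient.mk q.asIdeal (1 - e)
  by_cases hq : q = p
  · subst hq
    rw [Pi.single_eq_same, hy, map_sub, map_one,
      Ideal.Quotient.eq_zero_iff_mem.mpr ((hVe q).mpr rfl), sub_zero]
  · rw [Pi.single_eq_of_ne hq, zero_mul, map_sub, map_one,
      q.isPrime.mk_eq_one_of_mul_self_eq hidem (mt (hVe q).mp hq), sub_self]

/-- The map `A → B / I` is an essential extension as soon as `I` meets `A` trivially and every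
strictly larger ideal `I + xB` meets `A` nontrivially. -/
lemma isEssentialExtension_mk_comp {A B : Type*} [CommRing A] [CommRing B] (f : A →+* B)
    (I : Ideal B) (hI : ∀ a : A, f a ∈ I → a = 0)
    (hmax : ∀ x : B, x ∉ I → ∃ a : A, a ≠ 0 ∧ f a ∈ I ⊔ Ideal.span {x}) :
    IsEssentialExtension ((Ideal.Quotient.mk I).comp f) := by
  refine ⟨(injective_iff_map_eq_zero _).mpr fun a ha =>
    hI a (Ideal.Quotient.eq_zero_iff_mem.mp ha), fun J hJ => ?_⟩
  obtain ⟨y, hyJ, hy⟩ := Submodule.exists_mem_ne_zero_of_ne_bot hJ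
  obtain ⟨x, rfl⟩ := Ideal.Quotient.mk_surjective y
  obtain ⟨a, ha, hmem⟩ := hmax x fun h => hy (Ideal.Quotient.eq_zero_iff_mem.mpr h)
  have hle : I ⊔ Ideal.span {x} ≤ J.comap (Ideal.Quotient.mk I) := by
    refine sup_le (fun z hz => ?_) ((Ideal.span_singleton_le_iff_mem _).mpr hyJ)
    rw [Ideal.mem_comap, Ideal.Quotient.eq_zero_iff_mem.mpr hz]
    exact J.zero_mem
  exact ⟨a, hle hmem, fun h => ha (hI a (Ideal.Quotient.eq_zero_iff_mem.mp h))⟩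

/-- Let `A` be a real Baer von Neumann regular ring, `p` an isolated
point of `Spec A`, `e ∈ A` an idempotent with `V(e) = {p}`, and regard `A` as a subring
of `B = ∏_{q ∈ Spec A} A / q` via the canonical embedding.  If `I` is an ideal of `B`
contained in `eB` meeting `A` trivially which is maximal with these properties (i.e.
`(I + xB) ∩ A ≠ 0` for every `x ∈ eB ∖ I`), then `(I + xB) ∩ A ≠ 0` for every
`x ∈ B ∖ I`; equivalently, the induced map `A → B / I` is an essential ring extension. -/
theorem essential_of_maximal_ideal_in_idempotent_part
    (A : Type u) [CommRing A] (hreal : IsRealRing A) (hBaer : IsBaerRing A)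
    (hvnr : IsVonNeumannRegular A)
    (p : PrimeSpectrum A) (hiso : IsOpen ({p} : Set (PrimeSpectrum A)))
    (e : A) (hidem : e * e = e)
    (hVe : ∀ q : PrimeSpectrum A, e ∈ q.asIdeal ↔ q = p)
    (I : Ideal (∀ q : PrimeSpectrum A, A ⧸ q.asIdeal))
    (hIe : I ≤ Ideal.span {residueEmbedding A e})
    (hIA : ∀ a : A, residueEmbedding A a ∈ I → a = 0)
    (hImax : ∀ x ∈ Ideal.span {residueEmbedding A e}, x ∉ I →
      ∃ a : A, a ≠ 0 ∧ residueEmbedding A a ∈ I ⊔ Ideal.span {x}) :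
    (∀ x : ∀ q : PrimeSpectrum A, A ⧸ q.asIdeal, x ∉ I →
      ∃ a : A, a ≠ 0 ∧ residueEmbedding A a ∈ I ⊔ Ideal.span {x}) ∧
    IsEssentialExtension ((Ideal.Quotient.mk I).comp (residueEmbedding A)) := by
  have hmax : ∀ x : ∀ q : PrimeSpectrum A, A ⧸ q.asIdeal, x ∉ I →
      ∃ a : A, a ≠ 0 ∧ residueEmbedding A a ∈ I ⊔ Ideal.span {x} := by
    intro x hxI
    by_cases hx : x p = 0
    · exact hImax x (mem_span_residueEmbedding_of_apply_eq_zero hidem hVe hx) hxI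
    · refine ⟨1 - e, fun h => ?_,
        Ideal.mem_sup_right (residueEmbedding_one_sub_mem_span hvnr hidem hVe hx)⟩
      have he : (1 : A) ∈ p.asIdeal := by
        rw [sub_eq_zero.mp h]
        exact (hVe p).mpr rfl
      exact p.isPrime.one_notMem he
  exact ⟨hmax, isEssentialExtension_mk_comp _ I hIA hmax⟩
end
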